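/- de Bruijn identity along the flow (quantum conditioning): Let X be a random variable with values in ℝⁿ correlated with a finite-dimensional quantum system M, with E‖X‖² finite, with the map x ↦ ρ(x) (the state of M conditioned on X = x) continuous in trace norm, and with S(X|M) finite. Let Z be a standard Gaussian random variable on ℝⁿ independent of (X, M). Then for every t > 0, the function s ↦ S(X + √s Z | M) is differentiable at s = t and d/dt S(X + √t Z | M) = J(X + √t Z | M). -/

import Mathlib

open MeasureTheory Real Filter Topology
open scoped ComplexOrder

noncomputable section

/-- `ℝⁿ`. -/
abbrev En (n : ℕ) := EuclideanSpace ℝ (Fin n)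

/-- The density of the standard Gaussian probability measure on `ℝⁿ`. -/
def gaussDensity (n : ℕ) (z : En n) : ℝ :=
  (2 * π) ^ (-(n : ℝ) / 2) * Real.exp (-‖z‖ ^ 2 / 2)

/-- A state of a finite-dimensional quantum system: a positive semidefinite matrix
with unit trace. -/
def IsState {ι : Type*} [Fintype ι] [DecidableEq ι] (ρ : Matrix ι ι ℂ) : Prop :=
  ρ.PosSemidef ∧ ρ.trace = 1

open scoped Classical in
/-- The von Neumann entropy `S(ρ) = -Σᵢ λᵢ ln λᵢ` of a (Hermitian) matrix, the sum running
over its eigenvalues (with the convention `0 ln 0 = 0`; junk value `0` on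
non-Hermitian matrices). -/
def vnEnt {ι : Type*} [Fintype ι] [DecidableEq ι] (ρ : Matrix ι ι ℂ) : ℝ :=
  if h : ρ.IsHermitian then -∑ i, h.eigenvalues i * Real.log (h.eigenvalues i) else 0

/-- The classical (differential or discrete) entropy `S = -∫ p ln p` of a density `p`. -/
def clEnt {α : Type*} [MeasureSpace α] (p : α → ℝ) : ℝ := -∫ a, p a * Real.log (p a)

/-- The average state `∫ p(a) ρ(a) da` of a classical-quantum state. -/
def avgState {α : Type*} [MeasureSpace α] {d : ℕ} (p : α → ℝ)
    (ρ : α → Matrix (Fin d) (Fin d) ℂ) : Matrix (Fin d) (Fin d) ℂ :=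
  Matrix.of fun i j => ∫ a, (p a : ℂ) * ρ a i j

/-- The conditional entropy `S(A|M) = S(M|A) + S(A) - S(M)` of the classical system `A`
of a classical-quantum state `(p, ρ)` given the quantum system `M`. -/
def condEnt {α : Type*} [MeasureSpace α] {d : ℕ} (p : α → ℝ)
    (ρ : α → Matrix (Fin d) (Fin d) ℂ) : ℝ :=
  (∫ a, p a * vnEnt (ρ a)) + clEnt p - vnEnt (avgState p ρ)

/-- The integrability conditions expressing that the conditional entropy `S(A|M)` of the
classical-quantum state `(p, ρ)` is finite. -/
def EntFinite {α : Type*} [MeasureSpace α] {d : ℕ} (p : α → ℝ)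
    (ρ : α → Matrix (Fin d) (Fin d) ℂ) : Prop :=
  Integrable (fun a => p a * Real.log (p a)) ∧ Integrable (fun a => p a * vnEnt (ρ a))

/-- The marginal density of the first variable of a joint density on `ℝⁿ × ℝⁿ`. -/
def margFst {n : ℕ} (p : En n × En n → ℝ) : En n → ℝ := fun x => ∫ y, p (x, y)

/-- The state of `M` conditioned on the first classical variable:
`ρ_X(x) = (∫ p(x,y) ρ(x,y) dy) / p_X(x)`. -/
def margFstState {n d : ℕ} (p : En n × En n → ℝ)
    (ρ : En n × En n → Matrix (Fin d) (Fin d) ℂ) : En n → Matrix (Fin d) (Fin d) ℂ :=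
  fun x => ((margFst p x : ℂ))⁻¹ • Matrix.of fun i j => ∫ y, (p (x, y) : ℂ) * ρ (x, y) i j

/-- The marginal density of the second variable of a joint density on `ℝⁿ × ℝⁿ`. -/
def margSnd {n : ℕ} (p : En n × En n → ℝ) : En n → ℝ := fun y => ∫ x, p (x, y)

/-- The state of `M` conditioned on the second classical variable. -/
def margSndState {n d : ℕ} (p : En n × En n → ℝ)
    (ρ : En n × En n → Matrix (Fin d) (Fin d) ℂ) : En n → Matrix (Fin d) (Fin d) ℂ :=
  fun y => ((margSnd p y : ℂ))⁻¹ • Matrix.of fun i j => ∫ x, (p (x, y) : ℂ) * ρ (x, y) i j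

/-- The density of the sum `X + Y`: `p_S(s) = ∫ p(x, s - x) dx`. -/
def sumDensity {n : ℕ} (p : En n × En n → ℝ) : En n → ℝ := fun s => ∫ x, p (x, s - x)

/-- The state of `M` conditioned on `X + Y = s`. -/
def sumState {n d : ℕ} (p : En n × En n → ℝ)
    (ρ : En n × En n → Matrix (Fin d) (Fin d) ℂ) : En n → Matrix (Fin d) (Fin d) ℂ :=
  fun s => ((sumDensity p s : ℂ))⁻¹ •
    Matrix.of fun i j => ∫ x, (p (x, s - x) : ℂ) * ρ (x, s - x) i j

/-- The conditional mutual information `I(X:Y|M) = S(X|M) + S(Y|M) - S(X,Y|M)` of the two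
classical variables of a joint classical-quantum state on `ℝⁿ × ℝⁿ` given `M`. -/
def condMI {n d : ℕ} (p : En n × En n → ℝ)
    (ρ : En n × En n → Matrix (Fin d) (Fin d) ℂ) : ℝ :=
  condEnt (margFst p) (margFstState p ρ) + condEnt (margSnd p) (margSndState p ρ)
    - condEnt p ρ

/-- The joint density of `(A + c Z, Z)` where `A` has density `q` and `Z` is an independent
standard Gaussian. -/
def noisyDensity {n : ℕ} (c : ℝ) (q : En n → ℝ) : En n × En n → ℝ :=
  fun wz => gaussDensity n wz.2 * q (wz.1 - c • wz.2)

/-- The state of `M` conditioned on `A + c Z = w` and `Z = z`, namely `σ(w - c z)`. -/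
def noisyState {n d : ℕ} (c : ℝ) (σ : En n → Matrix (Fin d) (Fin d) ℂ) :
    En n × En n → Matrix (Fin d) (Fin d) ℂ :=
  fun wz => σ (wz.1 - c • wz.2)

/-- The mutual information `I(A + c Z : Z | M)` for a classical-quantum state `(q, σ)`. -/
def noisyMI {n d : ℕ} (c : ℝ) (q : En n → ℝ) (σ : En n → Matrix (Fin d) (Fin d) ℂ) : ℝ :=
  condMI (noisyDensity c q) (noisyState c σ)

/-- The heat-semigroup-evolved conditional entropy `t ↦ S(A + √t Z | M)`. -/
def heatEnt {n d : ℕ} (q : En n → ℝ) (σ : En n → Matrix (Fin d) (Fin d) ℂ) (t : ℝ) : ℝ :=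
  condEnt (margFst (noisyDensity (Real.sqrt t) q))
    (margFstState (noisyDensity (Real.sqrt t) q) (noisyState (Real.sqrt t) σ))

/-- The difference quotient `I(A + √t Z : Z | M) / t` whose limit as `t → 0⁺` is the
conditional Fisher information `J(A|M)`. -/
def fisherSlope {n d : ℕ} (q : En n → ℝ) (σ : En n → Matrix (Fin d) (Fin d) ℂ) (t : ℝ) : ℝ :=
  noisyMI (Real.sqrt t) q σ / t

/-- The conditional Fisher information `J(A|M) = lim_{t→0⁺} I(A + √t Z : Z | M) / t`, as an
extended real number (the limit always exists, and is computed here as a `limsup`). -/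
def condFisher {n d : ℕ} (q : En n → ℝ) (σ : En n → Matrix (Fin d) (Fin d) ℂ) : EReal :=
  Filter.limsup (fun t : ℝ => ((fisherSlope q σ t : ℝ) : EReal)) (𝓝[>] (0 : ℝ))

/-- The basic regularity hypotheses on a classical-quantum state `(p, ρ)`:
`p` is a probability density and `ρ` is a (trace-norm continuous) family of states. -/
def IsCQState {α : Type*} [MeasureSpace α] [TopologicalSpace α] {d : ℕ} (p : α → ℝ)
    (ρ : α → Matrix (Fin d) (Fin d) ℂ) : Prop :=
  Measurable p ∧ (∀ a, 0 ≤ p a) ∧ (∫ a, p a) = 1 ∧ Continuous ρ ∧ ∀ a, IsState (ρ a)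


open Matrix in
/-- Functional calculus through the eigenvector matrix. -/
def hcalc {d : ℕ} {A : Matrix (Fin d) (Fin d) ℂ} (hA : A.IsHermitian) (f : ℝ → ℝ) :
    Matrix (Fin d) (Fin d) ℂ :=
  (hA.eigenvectorUnitary : Matrix (Fin d) (Fin d) ℂ) *
    Matrix.diagonal (fun i => ((f (hA.eigenvalues i) : ℝ) : ℂ)) *
    star (hA.eigenvectorUnitary : Matrix (Fin d) (Fin d) ℂ)

theorem hcalc_eq_cfc {d : ℕ} {A : Matrix (Fin d) (Fin d) ℂ} (hA : A.IsHermitian) (f : ℝ → ℝ) :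
    cfc f A = hcalc hA f := by
  rw [hA.cfc_eq f]
  simp only [Matrix.IsHermitian.cfc, Unitary.conjStarAlgAut_apply, hcalc]
  rfl

theorem hcalc_id {d : ℕ} {A : Matrix (Fin d) (Fin d) ℂ} (hA : A.IsHermitian) :
    hcalc hA (fun x => x) = A := by
  conv_rhs => rw [hA.spectral_theorem]
  simp only [Unitary.conjStarAlgAut_apply, hcalc]
  rfl

theorem hcalc_mul {d : ℕ} {A : Matrix (Fin d) (Fin d) ℂ} (hA : A.IsHermitian) (f g : ℝ → ℝ) :
    hcalc hA f * hcalc hA g = hcalc hA (fun x => f x * g x) := by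
  unfold hcalc
  have h : star (hA.eigenvectorUnitary : Matrix (Fin d) (Fin d) ℂ) *
    (hA.eigenvectorUnitary : Matrix (Fin d) (Fin d) ℂ) = 1 := by simp
  calc _ = (hA.eigenvectorUnitary : Matrix (Fin d) (Fin d) ℂ) *
      Matrix.diagonal (fun i => ((f (hA.eigenvalues i) : ℝ) : ℂ)) *
      (star (hA.eigenvectorUnitary : Matrix (Fin d) (Fin d) ℂ) *
      (hA.eigenvectorUnitary : Matrix (Fin d) (Fin d) ℂ)) *
      Matrix.diagonal (fun i => ((g (hA.eigenvalues i) : ℝ) : ℂ)) *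
      star (hA.eigenvectorUnitary : Matrix (Fin d) (Fin d) ℂ) := by simp only [Matrix.mul_assoc]
    _ = _ := by
      rw [h, Matrix.mul_one, Matrix.mul_assoc (hA.eigenvectorUnitary : Matrix (Fin d) (Fin d) ℂ),
        Matrix.diagonal_mul_diagonal]
      push_cast
      rfl

theorem trace_hcalc {d : ℕ} {A : Matrix (Fin d) (Fin d) ℂ} (hA : A.IsHermitian) (f : ℝ → ℝ) :
    (hcalc hA f).trace = ((∑ i, f (hA.eigenvalues i) : ℝ) : ℂ) := by
  unfold hcalc
  rw [Matrix.trace_mul_cycle]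
  simp [Matrix.trace_diagonal]

/-- Overlap weights of two eigenbases. -/
def ovl {d : ℕ} {A B : Matrix (Fin d) (Fin d) ℂ} (hA : A.IsHermitian) (hB : B.IsHermitian)
    (i j : Fin d) : ℝ :=
  ‖(star (hA.eigenvectorUnitary : Matrix (Fin d) (Fin d) ℂ) *
    (hB.eigenvectorUnitary : Matrix (Fin d) (Fin d) ℂ)) i j‖ ^ 2

theorem unitary_row {d : ℕ} {Q : Matrix (Fin d) (Fin d) ℂ} (h : Q * star Q = 1) (i : Fin d) :
    ∑ j, ‖Q i j‖ ^ 2 = 1 := by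
  have h1 := congrFun (congrFun h i) i
  rw [Matrix.mul_apply] at h1
  simp only [Matrix.star_apply, Matrix.one_apply_eq] at h1
  have : ((∑ j, ‖Q i j‖ ^ 2 : ℝ) : ℂ) = 1 := by
    rw [← h1]; push_cast
    refine Finset.sum_congr rfl fun j _ => ?_
    exact (Complex.mul_conj' _).symm
  exact_mod_cast this

theorem unitary_col {d : ℕ} {Q : Matrix (Fin d) (Fin d) ℂ} (h : star Q * Q = 1) (j : Fin d) :
    ∑ i, ‖Q i j‖ ^ 2 = 1 := by
  have := unitary_row (Q := star Q) (by simpa using h) j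
  simpa [Matrix.star_apply] using this

theorem ovl_row {d : ℕ} {A B : Matrix (Fin d) (Fin d) ℂ} (hA : A.IsHermitian) (hB : B.IsHermitian)
    (i : Fin d) : ∑ j, ovl hA hB i j = 1 := by
  apply unitary_row
  exact (Unitary.mul_star_self (star hA.eigenvectorUnitary * hB.eigenvectorUnitary) |> congrArg Subtype.val)

theorem ovl_col {d : ℕ} {A B : Matrix (Fin d) (Fin d) ℂ} (hA : A.IsHermitian) (hB : B.IsHermitian)
    (j : Fin d) : ∑ i, ovl hA hB i j = 1 := by
  apply unitary_col
  exact (Unitary.star_mul_self (star hA.eigenvectorUnitary * hB.eigenvectorUnitary) |> congrArg Subtype.val)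

theorem ovl_nonneg {d : ℕ} {A B : Matrix (Fin d) (Fin d) ℂ} (hA : A.IsHermitian)
    (hB : B.IsHermitian) (i j : Fin d) : 0 ≤ ovl hA hB i j := by unfold ovl; positivity

theorem conj_hcalc_diag {d : ℕ} {A B : Matrix (Fin d) (Fin d) ℂ} (hA : A.IsHermitian)
    (hB : B.IsHermitian) (g : ℝ → ℝ) (i : Fin d) :
    (star (hA.eigenvectorUnitary : Matrix (Fin d) (Fin d) ℂ) * hcalc hB g *
      (hA.eigenvectorUnitary : Matrix (Fin d) (Fin d) ℂ)) i i
      = ((∑ j, g (hB.eigenvalues j) * ovl hA hB i j : ℝ) : ℂ) := by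
  have : star (hA.eigenvectorUnitary : Matrix (Fin d) (Fin d) ℂ) * hcalc hB g *
      (hA.eigenvectorUnitary : Matrix (Fin d) (Fin d) ℂ) =
      (star (hA.eigenvectorUnitary : Matrix (Fin d) (Fin d) ℂ) *
    (hB.eigenvectorUnitary : Matrix (Fin d) (Fin d) ℂ)) *
      Matrix.diagonal (fun i => ((g (hB.eigenvalues i) : ℝ) : ℂ)) *
      star (star (hA.eigenvectorUnitary : Matrix (Fin d) (Fin d) ℂ) *
    (hB.eigenvectorUnitary : Matrix (Fin d) (Fin d) ℂ)) := by
    unfold hcalc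
    simp only [star_mul, star_star, Matrix.mul_assoc]
  rw [this, Matrix.mul_apply]
  simp only [Matrix.mul_diagonal, Matrix.star_apply, ovl]
  push_cast
  refine Finset.sum_congr rfl fun j _ => ?_
  rw [← Complex.mul_conj']
  simp only [RCLike.star_def]
  ring

theorem trace_hcalc_mul {d : ℕ} {A B : Matrix (Fin d) (Fin d) ℂ} (hA : A.IsHermitian)
    (hB : B.IsHermitian) (f g : ℝ → ℝ) :
    (hcalc hA f * hcalc hB g).trace
      = ((∑ i, ∑ j, f (hA.eigenvalues i) * (g (hB.eigenvalues j) * ovl hA hB i j) : ℝ) : ℂ) := by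
  have : (hcalc hA f * hcalc hB g).trace =
    (Matrix.diagonal (fun i => ((f (hA.eigenvalues i) : ℝ) : ℂ)) *
      (star (hA.eigenvectorUnitary : Matrix (Fin d) (Fin d) ℂ) * hcalc hB g *
      (hA.eigenvectorUnitary : Matrix (Fin d) (Fin d) ℂ))).trace := by
    conv_lhs => rw [hcalc, Matrix.mul_assoc, Matrix.mul_assoc, Matrix.trace_mul_comm]
    simp only [Matrix.mul_assoc]
  rw [this, Matrix.trace]
  simp only [Matrix.diag_apply, Matrix.diagonal_mul, conj_hcalc_diag]
  push_cast
  simp only [Finset.mul_sum]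

theorem vnEnt_eq {d : ℕ} {A : Matrix (Fin d) (Fin d) ℂ} (hA : A.IsHermitian) :
    vnEnt A = ∑ i, Real.negMulLog (hA.eigenvalues i) := by
  simp [vnEnt, hA, Real.negMulLog, Finset.sum_neg_distrib]

theorem ovl_ker {d : ℕ} {A B : Matrix (Fin d) (Fin d) ℂ} (hA : A.PosSemidef) (hB : B.PosSemidef)
    (hker : ∀ v, B.mulVec v = 0 → A.mulVec v = 0) (i j : Fin d)
    (hj : hB.1.eigenvalues j = 0) : hA.1.eigenvalues i * ovl hA.1 hB.1 i j = 0 := by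
  classical
  set g : ℝ → ℝ := fun x => if x = 0 then 1 else 0
  have h0 : B * hcalc hB.1 g = 0 := by
    nth_rewrite 1 [← hcalc_id hB.1]
    rw [hcalc_mul]
    have : (fun x => x * g x) = fun _ => (0:ℝ) := by
      ext x; by_cases h : x = 0 <;> simp [g, h]
    rw [this]; simp [hcalc]
  have h1 : A * hcalc hB.1 g = 0 := by
    ext k l
    have := hker (fun m => hcalc hB.1 g m l) (by
      ext k; exact congrFun (congrFun h0 k) l)
    exact congrFun this k
  have h2 := trace_hcalc_mul hA.1 hB.1 (fun x => x) g
  rw [hcalc_id, h1, Matrix.trace_zero] at h2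
  have h3 : ∑ i, ∑ j, hA.1.eigenvalues i * (g (hB.1.eigenvalues j) * ovl hA.1 hB.1 i j) = 0 := by
    exact_mod_cast h2.symm
  have hnn : ∀ i j, 0 ≤ hA.1.eigenvalues i * (g (hB.1.eigenvalues j) * ovl hA.1 hB.1 i j) := by
    intro i j
    refine mul_nonneg (hA.eigenvalues_nonneg i) (mul_nonneg ?_ (ovl_nonneg _ _ _ _))
    simp only [g]; split_ifs <;> norm_num
  rw [Finset.sum_eq_zero_iff_of_nonneg (fun i _ => Finset.sum_nonneg fun j _ => hnn i j)] at h3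
  have h4 := h3 i (Finset.mem_univ _)
  rw [Finset.sum_eq_zero_iff_of_nonneg (fun j _ => hnn i j)] at h4
  simpa [g, hj] using h4 j (Finset.mem_univ _)

theorem klein_scalar {a b : ℝ} (ha : 0 ≤ a) (hb : 0 < b) :
    a * Real.log b + a - b ≤ a * Real.log a := by
  rcases ha.eq_or_lt with rfl | ha
  · simp; exact hb.le
  · have := Real.log_le_sub_one_of_pos (div_pos hb ha)
    rw [Real.log_div hb.ne' ha.ne'] at this
    have h2 := mul_le_mul_of_nonneg_left this ha.le
    have : a * (b / a - 1) = b - a := by field_simp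
    linarith

/-- Klein inequality. -/
theorem klein {d : ℕ} {A B : Matrix (Fin d) (Fin d) ℂ} (hA : A.PosSemidef) (hB : B.PosSemidef)
    (hker : ∀ v, B.mulVec v = 0 → A.mulVec v = 0) :
    ((A - B) * hcalc hB.1 Real.log).trace.re + (A - B).trace.re ≤ vnEnt B - vnEnt A := by
  have e1 : (A * hcalc hB.1 Real.log).trace.re = ∑ i, ∑ j, hA.1.eigenvalues i *
      (Real.log (hB.1.eigenvalues j) * ovl hA.1 hB.1 i j) := by
    nth_rewrite 1 [← hcalc_id hA.1]
    rw [trace_hcalc_mul, Complex.ofReal_re]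
  have e2 : (B * hcalc hB.1 Real.log).trace.re = - vnEnt B := by
    nth_rewrite 1 [← hcalc_id hB.1]
    rw [hcalc_mul, trace_hcalc, Complex.ofReal_re, vnEnt_eq hB.1]
    simp [Real.negMulLog]
  have e3 : A.trace.re = ∑ i, ∑ j, hA.1.eigenvalues i * ovl hA.1 hB.1 i j := by
    simp only [← Finset.mul_sum, ovl_row, mul_one]
    rw [hA.1.trace_eq_sum_eigenvalues]; simp
  have e4 : B.trace.re = ∑ i, ∑ j, hB.1.eigenvalues j * ovl hA.1 hB.1 i j := by
    rw [Finset.sum_comm]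
    simp only [← Finset.mul_sum, ovl_col, mul_one]
    rw [hB.1.trace_eq_sum_eigenvalues]; simp
  have e5 : - vnEnt A = ∑ i, ∑ j, (hA.1.eigenvalues i * Real.log (hA.1.eigenvalues i)) *
      ovl hA.1 hB.1 i j := by
    simp only [← Finset.mul_sum, ovl_row, mul_one]
    rw [vnEnt_eq hA.1]; simp [Real.negMulLog]
  rw [Matrix.sub_mul, Matrix.trace_sub, Matrix.trace_sub, Complex.sub_re, Complex.sub_re, e2]
  suffices (A * hcalc hB.1 Real.log).trace.re + A.trace.re - B.trace.re ≤ - vnEnt A by linarith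
  rw [e1, e3, e4, e5, ← Finset.sum_add_distrib, ← Finset.sum_sub_distrib]
  refine Finset.sum_le_sum fun i _ => ?_
  rw [← Finset.sum_add_distrib, ← Finset.sum_sub_distrib]
  refine Finset.sum_le_sum fun j _ => ?_
  have hw := ovl_nonneg hA.1 hB.1 i j
  rcases (hB.eigenvalues_nonneg j).eq_or_lt with h | h
  · have := ovl_ker hA hB hker i j h.symm
    have h5 : hA.1.eigenvalues i * Real.log (hA.1.eigenvalues i) * ovl hA.1 hB.1 i j = 0 := by
      rw [mul_right_comm, this, zero_mul]
    rw [h5, this, ← h]; simp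
  · have := mul_le_mul_of_nonneg_right (klein_scalar (hA.eigenvalues_nonneg i) h) hw
    nlinarith

theorem hcalc_entry_le {d : ℕ} {B : Matrix (Fin d) (Fin d) ℂ} (hB : B.IsHermitian) (g : ℝ → ℝ)
    {Λ : ℝ} (hΛ : ∀ i, |g (hB.eigenvalues i)| ≤ Λ) (i j : Fin d) :
    ‖hcalc hB g i j‖ ≤ d * Λ := by
  rw [hcalc, Matrix.mul_apply]
  refine (norm_sum_le _ _).trans ?_
  calc _ ≤ ∑ _k : Fin d, Λ := by
        refine Finset.sum_le_sum fun k _ => ?_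
        rw [Matrix.mul_diagonal, norm_mul, norm_mul, Matrix.star_apply, norm_star,
          Complex.norm_real, Real.norm_eq_abs]
        have h1 := entry_norm_bound_of_unitary hB.eigenvectorUnitary.2 i k
        have h2 := entry_norm_bound_of_unitary hB.eigenvectorUnitary.2 j k
        have h3 := hΛ k
        have h0 : 0 ≤ Λ := (abs_nonneg _).trans h3
        calc _ ≤ 1 * Λ * 1 := by gcongr
          _ = Λ := by ring
    _ = _ := by simp

theorem trace_bound {d : ℕ} {D L : Matrix (Fin d) (Fin d) ℂ} {δ Λ : ℝ} (hΛ : 0 ≤ Λ)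
    (hD : ∀ i j, ‖D i j‖ ≤ δ) (hL : ∀ i j, ‖L i j‖ ≤ Λ) :
    |(D * L).trace.re| ≤ d * (d * (δ * Λ)) := by
  refine (Complex.abs_re_le_norm _).trans ?_
  rw [Matrix.trace]
  refine (norm_sum_le _ _).trans ?_
  calc _ ≤ ∑ _i : Fin d, (d * (δ * Λ) : ℝ) := by
        refine Finset.sum_le_sum fun i _ => ?_
        rw [Matrix.diag_apply, Matrix.mul_apply]
        refine (norm_sum_le _ _).trans ?_
        calc _ ≤ ∑ _j : Fin d, (δ * Λ : ℝ) := by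
              refine Finset.sum_le_sum fun j _ => ?_
              rw [norm_mul]
              exact mul_le_mul (hD i j) (hL j i) (norm_nonneg _) ((norm_nonneg _).trans (hD i j))
          _ = _ := by simp
    _ = _ := by simp

theorem trace_bound1 {d : ℕ} {D : Matrix (Fin d) (Fin d) ℂ} {δ : ℝ}
    (hD : ∀ i j, ‖D i j‖ ≤ δ) : |D.trace.re| ≤ d * δ := by
  refine (Complex.abs_re_le_norm _).trans ?_
  rw [Matrix.trace]
  refine (norm_sum_le _ _).trans ?_
  calc _ ≤ ∑ _i : Fin d, (δ : ℝ) := Finset.sum_le_sum fun i _ => hD i i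
    _ = _ := by simp

theorem vn_lip {d : ℕ} {A B : Matrix (Fin d) (Fin d) ℂ} (hA : A.PosSemidef) (hB : B.PosSemidef)
    (hker : ∀ v, B.mulVec v = 0 ↔ A.mulVec v = 0) {Λ δ : ℝ} (hΛ : 0 ≤ Λ)
    (hlA : ∀ i, |Real.log (hA.1.eigenvalues i)| ≤ Λ)
    (hlB : ∀ i, |Real.log (hB.1.eigenvalues i)| ≤ Λ)
    (hD : ∀ i j, ‖A i j - B i j‖ ≤ δ) :
    |vnEnt A - vnEnt B| ≤ (d * (d * (δ * (d * Λ))) + d * δ) := by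
  have hD1 : ∀ i j, ‖(A - B) i j‖ ≤ δ := hD
  have hD2 : ∀ i j, ‖(B - A) i j‖ ≤ δ := fun i j => by
    rw [Matrix.sub_apply, norm_sub_rev]; exact hD i j
  have k1 := klein hA hB fun v => (hker v).1
  have k2 := klein hB hA fun v => (hker v).2
  have h0 : 0 ≤ d * Λ := by positivity
  have b1 := abs_le.1 (trace_bound h0 hD1 (hcalc_entry_le hB.1 Real.log hlB))
  have b2 := abs_le.1 (trace_bound h0 hD2 (hcalc_entry_le hA.1 Real.log hlA))
  have b3 := abs_le.1 (trace_bound1 hD1)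
  have b4 := abs_le.1 (trace_bound1 hD2)
  rw [abs_le]; constructor <;> linarith

theorem eig_lower {d : ℕ} {W : Matrix (Fin d) (Fin d) ℂ} (hW : W.PosSemidef) :
    ∃ w0 : ℝ, 0 < w0 ∧ ∀ (H : Matrix (Fin d) (Fin d) ℂ) (hH : H.PosSemidef) (c : ℝ), 0 ≤ c →
      (∀ v, W.mulVec v = 0 → H.mulVec v = 0) →
      (∀ v, c * (star v ⬝ᵥ W.mulVec v).re ≤ (star v ⬝ᵥ H.mulVec v).re) →
      ∀ i, hH.1.eigenvalues i = 0 ∨ c * w0 ≤ hH.1.eigenvalues i := by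
  classical
  obtain ⟨w0, hw0, hw⟩ : ∃ w0 : ℝ, 0 < w0 ∧
      ∀ j, hW.1.eigenvalues j = 0 ∨ w0 ≤ hW.1.eigenvalues j := by
    let s : Finset ℝ := insert 1 ((Finset.univ.image hW.1.eigenvalues).filter (fun x => x ≠ 0))
    have hs : s.Nonempty := ⟨1, by simp [s]⟩
    refine ⟨s.min' hs, ?_, fun j => ?_⟩
    · rw [Finset.lt_min'_iff]
      intro y hy
      simp only [s, Finset.mem_insert, Finset.mem_filter, Finset.mem_image, Finset.mem_univ,
        true_and] at hy
      rcases hy with rfl | ⟨⟨j, rfl⟩, h⟩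
      · norm_num
      · exact lt_of_le_of_ne (hW.eigenvalues_nonneg j) (Ne.symm h)
    · by_cases h : hW.1.eigenvalues j = 0
      · exact Or.inl h
      · right; apply Finset.min'_le; simp [s, h]
  refine ⟨w0, hw0, fun H hH c hc hker hq i => ?_⟩
  by_cases hi : hH.1.eigenvalues i = 0
  · exact Or.inl hi
  right
  have key : ∀ N : Matrix (Fin d) (Fin d) ℂ,
      star (fun k => (hH.1.eigenvectorUnitary : Matrix (Fin d) (Fin d) ℂ) k i) ⬝ᵥ
      N.mulVec (fun k => (hH.1.eigenvectorUnitary : Matrix (Fin d) (Fin d) ℂ) k i) =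
      (star (hH.1.eigenvectorUnitary : Matrix (Fin d) (Fin d) ℂ) * N *
      (hH.1.eigenvectorUnitary : Matrix (Fin d) (Fin d) ℂ)) i i := by
    intro N
    rw [Matrix.mul_assoc, Matrix.mul_apply]
    simp only [dotProduct, Matrix.star_apply, Matrix.mul_apply, Matrix.mulVec, Pi.star_apply]
  have h1 := hq (fun k => (hH.1.eigenvectorUnitary : Matrix (Fin d) (Fin d) ℂ) k i)
  rw [key, key] at h1
  nth_rewrite 1 [← hcalc_id hW.1] at h1
  rw [conj_hcalc_diag] at h1
  have h2 : (star (hH.1.eigenvectorUnitary : Matrix (Fin d) (Fin d) ℂ) * H *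
      (hH.1.eigenvectorUnitary : Matrix (Fin d) (Fin d) ℂ)) i i = hH.1.eigenvalues i := by
    have hu : star (hH.1.eigenvectorUnitary : Matrix (Fin d) (Fin d) ℂ) *
      (hH.1.eigenvectorUnitary : Matrix (Fin d) (Fin d) ℂ) = 1 := by simp
    have : star (hH.1.eigenvectorUnitary : Matrix (Fin d) (Fin d) ℂ) * hcalc hH.1 (fun x => x) *
      (hH.1.eigenvectorUnitary : Matrix (Fin d) (Fin d) ℂ) =
      Matrix.diagonal (fun i => ((hH.1.eigenvalues i : ℝ) : ℂ)) := by
      rw [hcalc]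
      calc _ = (star (hH.1.eigenvectorUnitary : Matrix (Fin d) (Fin d) ℂ) *
        (hH.1.eigenvectorUnitary : Matrix (Fin d) (Fin d) ℂ)) *
        Matrix.diagonal (fun i => ((hH.1.eigenvalues i : ℝ) : ℂ)) *
        (star (hH.1.eigenvectorUnitary : Matrix (Fin d) (Fin d) ℂ) *
        (hH.1.eigenvectorUnitary : Matrix (Fin d) (Fin d) ℂ)) := by simp only [Matrix.mul_assoc]
        _ = _ := by rw [hu]; simp
    rw [hcalc_id] at this
    rw [this]; simp
  rw [h2, Complex.ofReal_re, Complex.ofReal_re] at h1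
  refine le_trans (mul_le_mul_of_nonneg_left ?_ hc) h1
  calc w0 = ∑ j, w0 * ovl hH.1 hW.1 i j := by rw [← Finset.mul_sum, ovl_row, mul_one]
    _ ≤ _ := by
      refine Finset.sum_le_sum fun j _ => ?_
      rcases hw j with h | h
      · have := ovl_ker hH hW hker i j h
        rcases mul_eq_zero.1 this with h' | h'
        · exact absurd h' hi
        · rw [h']; simp
      · exact mul_le_mul_of_nonneg_right h (ovl_nonneg _ _ _ _)

theorem eig_le_trace {d : ℕ} {A : Matrix (Fin d) (Fin d) ℂ} (hA : A.PosSemidef) (i : Fin d) :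
    hA.1.eigenvalues i ≤ A.trace.re := by
  rw [hA.1.trace_eq_sum_eigenvalues]
  simp only [Complex.re_sum]
  exact Finset.single_le_sum (f := fun i => hA.1.eigenvalues i)
    (fun j _ => hA.eigenvalues_nonneg j) (Finset.mem_univ i)

section
open scoped Matrix.Norms.L2Operator

theorem tendsto_cfc_matrix {d : ℕ} {X : Type*} {l : Filter X}
    {A : X → Matrix (Fin d) (Fin d) ℂ} {A0 : Matrix (Fin d) (Fin d) ℂ}
    (hA : Tendsto A l (𝓝 A0)) {s : Set ℝ} (hs : IsCompact s) (f : ℝ → ℝ) (hf : ContinuousOn f s)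
    (h1 : ∀ᶠ x in l, (A x).IsHermitian ∧ spectrum ℝ (A x) ⊆ s)
    (h2 : A0.IsHermitian ∧ spectrum ℝ A0 ⊆ s) :
    Tendsto (fun x => cfc f (A x)) l (𝓝 (cfc f A0)) :=
  Filter.Tendsto.cfc hs f hA (h1.mono fun _ h => h.2) (h1.mono fun _ h => h.1.isSelfAdjoint) h2.2
    h2.1.isSelfAdjoint hf
end

theorem vnEnt_eq_cfc {d : ℕ} {A : Matrix (Fin d) (Fin d) ℂ} (hA : A.IsHermitian) :
    vnEnt A = (cfc Real.negMulLog A).trace.re := by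
  rw [hcalc_eq_cfc hA, trace_hcalc, Complex.ofReal_re, vnEnt_eq hA]

theorem continuous_vnEnt {d : ℕ} {X : Type*} [TopologicalSpace X]
    {A : X → Matrix (Fin d) (Fin d) ℂ} (hA : Continuous A) (hp : ∀ x, (A x).PosSemidef) :
    Continuous fun x => vnEnt (A x) := by
  have : (fun x => vnEnt (A x)) = fun x => (cfc Real.negMulLog (A x)).trace.re :=
    funext fun x => vnEnt_eq_cfc (hp x).1
  rw [this, continuous_iff_continuousAt]
  intro x0
  have ht : Continuous fun x => (A x).trace.re := Complex.continuous_re.comp hA.matrix_trace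
  have hev : ∀ᶠ x in 𝓝 x0, (A x).trace.re < (A x0).trace.re + 1 :=
    ht.continuousAt.eventually_lt continuousAt_const (by simp)
  have hsp : ∀ x, (A x).trace.re < (A x0).trace.re + 1 →
      (A x).IsHermitian ∧ spectrum ℝ (A x) ⊆ Set.Icc 0 ((A x0).trace.re + 1) := by
    intro x hx
    refine ⟨(hp x).1, ?_⟩
    rw [(hp x).1.spectrum_real_eq_range_eigenvalues]
    rintro _ ⟨i, rfl⟩
    exact ⟨(hp x).eigenvalues_nonneg i, (eig_le_trace (hp x) i).trans hx.le⟩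
  have := tendsto_cfc_matrix (hA.tendsto x0) isCompact_Icc Real.negMulLog
    Real.continuous_negMulLog.continuousOn (hev.mono hsp) (hsp x0 (by simp))
  exact (Complex.continuous_re.tendsto _).comp
    (((continuous_id.matrix_trace : Continuous (Matrix.trace : Matrix (Fin d) (Fin d) ℂ → ℂ)).tendsto _).comp this)

theorem vnEnt_smul {d : ℕ} {A : Matrix (Fin d) (Fin d) ℂ} (hA : A.IsHermitian) (c : ℝ) :
    vnEnt ((c : ℂ) • A) = c * vnEnt A + Real.negMulLog c * A.trace.re := by
  have h : ((c : ℂ) • A) = c • A := by ext i j; simp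
  have hcA : (c • A).IsHermitian := by
    unfold Matrix.IsHermitian
    rw [Matrix.conjTranspose_smul, hA.eq]; simp
  rw [h, vnEnt_eq_cfc hcA, ← cfc_comp_smul c Real.negMulLog A
    (Real.continuous_negMulLog.continuousOn) hA.isSelfAdjoint, hcalc_eq_cfc hA, trace_hcalc,
    Complex.ofReal_re, vnEnt_eq hA, hA.trace_eq_sum_eigenvalues]
  simp only [smul_eq_mul, Real.negMulLog_mul, Finset.sum_add_distrib]
  rw [Finset.mul_sum, add_comm]
  congr 1
  simp only [Complex.re_sum, Finset.mul_sum]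
  refine Finset.sum_congr rfl fun i _ => ?_
  rw [mul_comm]; rfl

theorem vn_deriv {d : ℕ} {A : ℝ → Matrix (Fin d) (Fin d) ℂ} {A' : Matrix (Fin d) (Fin d) ℂ}
    {t a b : ℝ} {S : Set ℝ} (hS : S ∈ 𝓝 t) (hp : ∀ s ∈ S, (A s).PosSemidef)
    (hker : ∀ s ∈ S, ∀ v, (A s).mulVec v = 0 ↔ (A t).mulVec v = 0) (ha : 0 < a)
    (heig : ∀ s (hs : s ∈ S), ∀ i, (hp s hs).1.eigenvalues i = 0 ∨
      (a ≤ (hp s hs).1.eigenvalues i ∧ (hp s hs).1.eigenvalues i ≤ b))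
    (hd : ∀ i j, HasDerivAt (fun s => A s i j) (A' i j) t) :
    ∃ D : ℝ, HasDerivAt (fun s => vnEnt (A s)) D t := by
  have htS : t ∈ S := mem_of_mem_nhds hS
  have hpt := hp t htS
  have hsl : Tendsto (fun s => (s - t)⁻¹ • (A s - A t)) (𝓝[≠] t) (𝓝 A') := by
    refine tendsto_pi_nhds.2 fun i => tendsto_pi_nhds.2 fun j => ?_
    have := hasDerivAt_iff_tendsto_slope.1 (hd i j)
    refine this.congr fun s => ?_
    simp [slope_def_module]
  have hcA : Tendsto A (𝓝[≠] t) (𝓝 (A t)) := by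
    refine tendsto_pi_nhds.2 fun i => tendsto_pi_nhds.2 fun j => ?_
    exact (hd i j).continuousAt.tendsto.mono_left nhdsWithin_le_nhds
  have hK : IsCompact ({0} ∪ Set.Icc a b : Set ℝ) := isCompact_singleton.union isCompact_Icc
  have hlog : ContinuousOn Real.log ({0} ∪ Set.Icc a b : Set ℝ) := by
    apply ContinuousOn.union_of_isClosed
    · exact continuousOn_singleton _ _
    · exact Real.continuousOn_log.mono fun x hx => by
        have := hx.1; simp; linarith
    · exact isClosed_singleton
    · exact isClosed_Icc
  have hsp : ∀ s ∈ S, (A s).IsHermitian ∧ spectrum ℝ (A s) ⊆ ({0} ∪ Set.Icc a b : Set ℝ) := by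
    intro s hs
    refine ⟨(hp s hs).1, ?_⟩
    rw [(hp s hs).1.spectrum_real_eq_range_eigenvalues]
    rintro _ ⟨i, rfl⟩
    exact heig s hs i
  have hev : ∀ᶠ s in 𝓝[≠] t, s ∈ S := mem_nhdsWithin_of_mem_nhds hS
  have hL := tendsto_cfc_matrix hcA hK Real.log hlog (hev.mono hsp) (hsp t htS)
  set T : Matrix (Fin d) (Fin d) ℂ → ℝ := fun M => M.trace.re with hT
  have hTc : Continuous T := Complex.continuous_re.comp continuous_id.matrix_trace
  set D : ℝ := T (A' * cfc Real.log (A t)) + T A'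
  have hlo : Tendsto (fun s => T (((s - t)⁻¹ • (A s - A t)) * cfc Real.log (A t)) +
      T ((s - t)⁻¹ • (A s - A t))) (𝓝[≠] t) (𝓝 D) :=
    ((hTc.tendsto _).comp (hsl.mul tendsto_const_nhds)).add ((hTc.tendsto _).comp hsl)
  have hhi : Tendsto (fun s => T (((s - t)⁻¹ • (A s - A t)) * cfc Real.log (A s)) +
      T ((s - t)⁻¹ • (A s - A t))) (𝓝[≠] t) (𝓝 D) :=
    ((hTc.tendsto _).comp (hsl.mul hL)).add ((hTc.tendsto _).comp hsl)
  have hTs : ∀ (c : ℝ) M, T (c • M) = c * T M := by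
    intro c M; simp [hT, Matrix.trace_smul]
  have hb : ∀ᶠ s in 𝓝[≠] t, ∀ u, u = slope (fun s => -vnEnt (A s)) t s →
      min (T (((s - t)⁻¹ • (A s - A t)) * cfc Real.log (A t)) + T ((s - t)⁻¹ • (A s - A t)))
        (T (((s - t)⁻¹ • (A s - A t)) * cfc Real.log (A s)) + T ((s - t)⁻¹ • (A s - A t))) ≤ u ∧
      u ≤ max (T (((s - t)⁻¹ • (A s - A t)) * cfc Real.log (A t)) + T ((s - t)⁻¹ • (A s - A t)))
        (T (((s - t)⁻¹ • (A s - A t)) * cfc Real.log (A s)) + T ((s - t)⁻¹ • (A s - A t))) := by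
    filter_upwards [hev, self_mem_nhdsWithin] with s hs hne u hu
    have k1 := klein (hp s hs) hpt fun v => (hker s hs v).2
    have k2 := klein hpt (hp s hs) fun v => (hker s hs v).1
    rw [← hcalc_eq_cfc] at k1 k2
    have k2' : -(T ((A s - A t) * cfc Real.log (A s)) + T (A s - A t)) ≤
        vnEnt (A s) - vnEnt (A t) := by
      refine le_trans (le_of_eq ?_) k2
      simp only [hT]
      rw [← neg_sub (A s) (A t), Matrix.neg_mul, Matrix.trace_neg, Matrix.trace_neg, Complex.neg_re,
        Complex.neg_re]
      ring
    have k1' : T ((A s - A t) * cfc Real.log (A t)) + T (A s - A t) ≤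
        vnEnt (A t) - vnEnt (A s) := k1
    simp only [Matrix.smul_mul, hTs, ← mul_add]
    have hu' : u = (s - t)⁻¹ * (vnEnt (A t) - vnEnt (A s)) := by
      rw [hu, slope_def_module, smul_eq_mul]; ring
    rw [hu']
    rcases lt_or_gt_of_ne hne with h | h
    · have hn : (s - t)⁻¹ ≤ 0 := inv_nonpos.2 (by linarith)
      exact ⟨(min_le_right _ _).trans (mul_le_mul_of_nonpos_left (by linarith) hn),
        (mul_le_mul_of_nonpos_left k1' hn).trans (le_max_left _ _)⟩
    · have hn : 0 ≤ (s - t)⁻¹ := inv_nonneg.2 (by linarith)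
      exact ⟨(min_le_left _ _).trans (mul_le_mul_of_nonneg_left k1' hn),
        (mul_le_mul_of_nonneg_left (by linarith) hn).trans (le_max_right _ _)⟩
  have hfin : HasDerivAt (fun s => -vnEnt (A s)) D t := by
    rw [hasDerivAt_iff_tendsto_slope]
    have h1 := hlo.min hhi
    have h2 := hlo.max hhi
    rw [min_self] at h1
    rw [max_self] at h2
    exact tendsto_of_tendsto_of_tendsto_of_le_of_le' h1 h2 (hb.mono fun s hs => (hs _ rfl).1)
      (hb.mono fun s hs => (hs _ rfl).2)
  refine ⟨-D, ?_⟩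
  have h := hfin.fun_neg
  simpa only [neg_neg] using h

theorem posSemidef_entry {d : ℕ} {A : Matrix (Fin d) (Fin d) ℂ} (hA : A.PosSemidef)
    (i j : Fin d) : ‖A i j‖ ≤ d * A.trace.re := by
  have := hcalc_entry_le hA.1 (fun x => x) (Λ := A.trace.re) (fun k => by
    rw [abs_of_nonneg (hA.eigenvalues_nonneg k)]; exact eig_le_trace hA k) i j
  rwa [hcalc_id] at this

/-- The heat kernel. -/
def hk (n : ℕ) (s : ℝ) (u : En n) : ℝ :=
  (2 * π * s) ^ (-(n : ℝ) / 2) * Real.exp (-‖u‖ ^ 2 / (2 * s))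

theorem hk_pos {n : ℕ} {s : ℝ} (hs : 0 < s) (u : En n) : 0 < hk n s u := by
  unfold hk; positivity

theorem hk_cont {n : ℕ} (s : ℝ) : Continuous (hk n s) := by
  unfold hk; fun_prop

theorem hk_le {n : ℕ} {s : ℝ} (hs : 0 < s) (u : En n) : hk n s u ≤ (2 * π * s) ^ (-(n : ℝ) / 2) := by
  unfold hk
  have h1 : Real.exp (-‖u‖ ^ 2 / (2 * s)) ≤ 1 := by
    rw [Real.exp_le_one_iff]
    apply div_nonpos_of_nonpos_of_nonneg <;> nlinarith [sq_nonneg ‖u‖]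
  have h2 : 0 ≤ (2 * π * s) ^ (-(n : ℝ) / 2) := by positivity
  nlinarith

theorem gexp_integrable {n : ℕ} {b : ℝ} (hb : 0 < b) :
    Integrable fun u : En n => Real.exp (-b * ‖u‖ ^ 2) := by
  have h := GaussianFourier.integrable_cexp_neg_mul_sq_norm_add (V := En n) (b := (b : ℂ))
    (by simpa using hb) 0 0
  have h2 := h.norm
  refine h2.congr (Eventually.of_forall fun u => ?_)
  simp only [zero_mul, add_zero, Complex.norm_exp]
  congr 1
  have : (-(b : ℂ) * (‖u‖ : ℂ) ^ 2) = ((-b * ‖u‖ ^ 2 : ℝ) : ℂ) := by push_cast; ring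
  rw [this, Complex.ofReal_re]

theorem hk_eq {n : ℕ} {s : ℝ} (hs : 0 < s) (u : En n) :
    hk n s u = (2 * π * s) ^ (-(n : ℝ) / 2) * Real.exp (-(1 / (2 * s)) * ‖u‖ ^ 2) := by
  unfold hk; congr 2; field_simp

theorem hk_integrable {n : ℕ} {s : ℝ} (hs : 0 < s) : Integrable (hk n s) := by
  have : hk n s = fun u => (2 * π * s) ^ (-(n : ℝ) / 2) * Real.exp (-(1 / (2 * s)) * ‖u‖ ^ 2) :=
    funext (hk_eq hs)
  rw [this]
  exact (gexp_integrable (by positivity)).const_mul _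

theorem gexp_integral {n : ℕ} {b : ℝ} (hb : 0 < b) :
    ∫ u : En n, Real.exp (-b * ‖u‖ ^ 2) = (π / b) ^ ((n : ℝ) / 2) := by
  have := GaussianFourier.integral_rexp_neg_mul_sq_norm (V := En n) hb
  simpa using this

theorem hk_integral {n : ℕ} {s : ℝ} (hs : 0 < s) : ∫ u, hk n s u = 1 := by
  have : hk n s = fun u => (2 * π * s) ^ (-(n : ℝ) / 2) * Real.exp (-(1 / (2 * s)) * ‖u‖ ^ 2) :=
    funext (hk_eq hs)
  rw [this, integral_const_mul, gexp_integral (by positivity)]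
  have : π / (1 / (2 * s)) = 2 * π * s := by field_simp
  rw [this, ← Real.rpow_add (by positivity)]
  have : -(n : ℝ) / 2 + n / 2 = 0 := by ring
  rw [this, Real.rpow_zero]

theorem gauss_eq_hk {n : ℕ} (z : En n) : gaussDensity n z = hk n 1 z := by
  simp [gaussDensity, hk]

theorem hk_scale {n : ℕ} {s : ℝ} (hs : 0 < s) (z : En n) :
    hk n s (√s • z) = (√s ^ n)⁻¹ * gaussDensity n z := by
  unfold hk gaussDensity
  rw [Real.mul_rpow (by positivity) hs.le, norm_smul, mul_pow, Real.norm_eq_abs, sq_abs,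
    Real.sq_sqrt hs.le]
  have h1 : -(s * ‖z‖ ^ 2) / (2 * s) = -‖z‖ ^ 2 / 2 := by field_simp
  have h2 : s ^ (-(n : ℝ) / 2) = (√s ^ n)⁻¹ := by
    rw [Real.sqrt_eq_rpow, ← Real.rpow_natCast, ← Real.rpow_mul hs.le, ← Real.rpow_neg hs.le]
    congr 1; ring
  rw [h1, h2]; ring

theorem gauss_to_hk {n : ℕ} {F : Type*} [NormedAddCommGroup F] [NormedSpace ℝ F] {s : ℝ}
    (hs : 0 < s) (f : En n → F) (x : En n) :
    ∫ z, gaussDensity n z • f (x - √s • z) = ∫ y, hk n s (x - y) • f y := by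
  have h1 : ∫ y, hk n s (x - y) • f y = ∫ u, hk n s u • f (x - u) := by
    rw [← integral_sub_left_eq_self (fun u => hk n s u • f (x - u)) volume x]
    simp
  have h2 := Measure.integral_comp_smul volume (fun u : En n => hk n s u • f (x - u)) (√s)
  have hsq : 0 < √s ^ n := by positivity
  simp only [hk_scale hs, mul_smul, integral_smul, finrank_euclideanSpace, Fintype.card_fin] at h2
  rw [abs_of_pos (inv_pos.2 hsq)] at h2
  rw [h1]
  exact smul_right_injective F (inv_ne_zero hsq.ne') h2

theorem hk_square {n : ℕ} {s t : ℝ} (hs : 0 < s) (ht : 0 < t) (u y : En n) :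
    hk n s (u - y) * hk n t y = (2 * π * s) ^ (-(n : ℝ) / 2) * (2 * π * t) ^ (-(n : ℝ) / 2) *
      Real.exp (-‖u‖ ^ 2 / (2 * (s + t))) *
      Real.exp (-((s + t) / (2 * s * t)) * ‖y - (t / (s + t)) • u‖ ^ 2) := by
  unfold hk
  have : Real.exp (-‖u - y‖ ^ 2 / (2 * s)) * Real.exp (-‖y‖ ^ 2 / (2 * t)) =
      Real.exp (-‖u‖ ^ 2 / (2 * (s + t))) *
      Real.exp (-((s + t) / (2 * s * t)) * ‖y - (t / (s + t)) • u‖ ^ 2) := by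
    rw [← Real.exp_add, ← Real.exp_add]
    congr 1
    rw [norm_sub_sq_real, norm_sub_sq_real, norm_smul, inner_smul_right, real_inner_comm u y,
      mul_pow, Real.norm_eq_abs, sq_abs]
    have : s + t ≠ 0 := by positivity
    field_simp
    ring
  calc _ = (2 * π * s) ^ (-(n : ℝ) / 2) * (2 * π * t) ^ (-(n : ℝ) / 2) *
      (Real.exp (-‖u - y‖ ^ 2 / (2 * s)) * Real.exp (-‖y‖ ^ 2 / (2 * t))) := by ring
    _ = _ := by rw [this]; ring

theorem hk_semigroup {n : ℕ} {s t : ℝ} (hs : 0 < s) (ht : 0 < t) (x w : En n) :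
    ∫ y, hk n s (x - y) * hk n t (y - w) = hk n (s + t) (x - w) := by
  have h1 : ∫ y, hk n s (x - y) * hk n t (y - w) = ∫ y, hk n s ((x - w) - y) * hk n t y := by
    rw [← integral_sub_right_eq_self (fun y => hk n s ((x - w) - y) * hk n t y) w]
    refine integral_congr_ae (Eventually.of_forall fun y => ?_)
    simp
  rw [h1]
  simp only [hk_square hs ht]
  rw [integral_const_mul,
    integral_sub_right_eq_self (fun y : En n => Real.exp (-((s + t) / (2 * s * t)) * ‖y‖ ^ 2)),
    gexp_integral (by positivity)]
  unfold hk
  have e : (2 * π * s) ^ (-(n : ℝ) / 2) * (2 * π * t) ^ (-(n : ℝ) / 2) *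
      (π / ((s + t) / (2 * s * t))) ^ ((n : ℝ) / 2) = (2 * π * (s + t)) ^ (-(n : ℝ) / 2) := by
    have h3 : (π / ((s + t) / (2 * s * t))) = ((2 * π * s) * (2 * π * t)) / (2 * π * (s + t)) := by
      field_simp
    have h4 : -(n : ℝ) / 2 = -((n : ℝ) / 2) := by ring
    rw [h3, h4, Real.rpow_neg (x := 2 * π * s) (by positivity),
      Real.rpow_neg (x := 2 * π * t) (by positivity),
      Real.rpow_neg (x := 2 * π * (s + t)) (by positivity),
      Real.div_rpow (by positivity) (by positivity),
      Real.mul_rpow (x := 2 * π * s) (y := 2 * π * t) (by positivity) (by positivity)]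
    have h5 : (2 * π * s) ^ ((n : ℝ) / 2) ≠ 0 := by positivity
    have h6 : (2 * π * t) ^ ((n : ℝ) / 2) ≠ 0 := by positivity
    have h7 : (2 * π * (s + t)) ^ ((n : ℝ) / 2) ≠ 0 := by positivity
    generalize (2 * π * s) ^ ((n : ℝ) / 2) = X at *
    generalize (2 * π * t) ^ ((n : ℝ) / 2) = Y at *
    generalize (2 * π * (s + t)) ^ ((n : ℝ) / 2) = Z at *
    field_simp
  rw [← e]; ring

/-- The heat flow of a vector valued function. -/
def hflow {n : ℕ} {F : Type*} [NormedAddCommGroup F] [NormedSpace ℝ F] (s : ℝ) (f : En n → F)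
    (x : En n) : F := ∫ y, hk n s (x - y) • f y

section
variable {n : ℕ} {F : Type*} [NormedAddCommGroup F] [NormedSpace ℝ F]

/-- Pointwise integrability against a bounded continuous kernel. -/
theorem ker_integrable {k : En n → ℝ} (hk0 : Continuous k) {B : ℝ} (hB : ∀ u, |k u| ≤ B)
    {f : En n → F} (hf : Integrable f) (x : En n) : Integrable fun y => k (x - y) • f y := by
  refine hf.bdd_smul B ?_ ?_
  · exact (hk0.comp (continuous_const.sub continuous_id)).aestronglyMeasurable
  · exact Eventually.of_forall fun y => by simpa using hB (x - y)

theorem hk_abs_le {s : ℝ} (hs : 0 < s) (u : En n) : |hk n s u| ≤ (2 * π * s) ^ (-(n : ℝ) / 2) := by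
  rw [abs_of_pos (hk_pos hs u)]; exact hk_le hs u

theorem hflow_pt {s : ℝ} (hs : 0 < s) {f : En n → F} (hf : Integrable f) (x : En n) :
    Integrable fun y => hk n s (x - y) • f y :=
  ker_integrable (hk_cont s) (hk_abs_le hs) hf x

theorem ker_prod_integrable {k : En n → ℝ} (hk0 : Integrable k)
    {f : En n → F} (hf : Integrable f) :
    Integrable (fun p : En n × En n => k (p.1 - p.2) • f p.2) (volume.prod volume) := by
  have := hf.convolution_integrand (ContinuousLinearMap.lsmul ℝ ℝ).flip hk0 (F := F)
  exact this

theorem ker_conv_integrable {k : En n → ℝ} (hk0 : Integrable k)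
    {f : En n → F} (hf : Integrable f) : Integrable (fun x => ∫ y, k (x - y) • f y) :=
  (ker_prod_integrable hk0 hf).integral_prod_left

theorem hflow_integrable {s : ℝ} (hs : 0 < s) {f : En n → F} (hf : Integrable f) :
    Integrable (hflow s f) := ker_conv_integrable (hk_integrable hs) hf

theorem hflow_continuous {s : ℝ} (hs : 0 < s) {f : En n → F} (hf : Integrable f) :
    Continuous (hflow s f) := by
  unfold hflow
  refine continuous_of_dominated (bound := fun y => (2 * π * s) ^ (-(n : ℝ) / 2) * ‖f y‖) ?_ ?_ ?_ ?_
  · exact fun x => (hflow_pt hs hf x).aestronglyMeasurable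
  · intro x
    refine Eventually.of_forall fun y => ?_
    rw [norm_smul]
    exact mul_le_mul_of_nonneg_right (hk_abs_le hs _) (norm_nonneg _)
  · exact hf.norm.const_mul _
  · refine Eventually.of_forall fun y => ?_
    exact ((hk_cont s).comp (continuous_id.sub continuous_const)).smul continuous_const

theorem hflow_integral [CompleteSpace F] {s : ℝ} (hs : 0 < s) {f : En n → F} (hf : Integrable f) :
    ∫ x, hflow s f x = ∫ x, f x := by
  have := integral_convolution (ContinuousLinearMap.lsmul ℝ ℝ (E := F)).flip hf
    (hk_integrable (n := n) hs)
  rw [hk_integral hs] at this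
  simp only [ContinuousLinearMap.flip_apply, ContinuousLinearMap.lsmul_apply, one_smul] at this
  exact this

theorem hflow_hflow [CompleteSpace F] {s t : ℝ} (hs : 0 < s) (ht : 0 < t) {f : En n → F}
    (hf : Integrable f) (x : En n) : hflow s (hflow t f) x = hflow (s + t) f x := by
  unfold hflow
  have h1 : ∀ z, hk n s (x - z) • ∫ y, hk n t (z - y) • f y =
      ∫ y, hk n s (x - z) • hk n t (z - y) • f y := fun z => (integral_smul _ _).symm
  simp only [h1]
  rw [integral_integral_swap]
  · refine integral_congr_ae (Eventually.of_forall fun y => ?_)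
    simp only [smul_smul]
    rw [integral_smul_const, hk_semigroup hs ht]
  · refine (ker_prod_integrable (hk_integrable ht) hf).bdd_smul ((2 * π * s) ^ (-(n : ℝ) / 2)) ?_ ?_
    · exact ((hk_cont s).comp (continuous_const.sub continuous_fst)).aestronglyMeasurable
    · exact Eventually.of_forall fun p => hk_abs_le hs _
end

/-- Time derivative of the heat kernel. -/
def dhk (n : ℕ) (s : ℝ) (u : En n) : ℝ :=
  (-(n : ℝ) / (2 * s) + ‖u‖ ^ 2 / (2 * s ^ 2)) * hk n s u

theorem hk_hasDerivAt {n : ℕ} {s : ℝ} (hs : 0 < s) (u : En n) :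
    HasDerivAt (fun s => hk n s u) (dhk n s u) s := by
  unfold hk dhk
  have h1 : HasDerivAt (fun s : ℝ => (2 * π * s) ^ (-(n : ℝ) / 2))
      ((2 * π * 1) * (-(n : ℝ) / 2) * (2 * π * s) ^ (-(n : ℝ) / 2 - 1)) s :=
    ((hasDerivAt_id s).const_mul (2 * π)).rpow_const (Or.inl (by simp; positivity))
  have h2 : HasDerivAt (fun s : ℝ => -‖u‖ ^ 2 / (2 * s)) (‖u‖ ^ 2 / (2 * s ^ 2)) s := by
    have := (hasDerivAt_inv hs.ne').const_mul (-‖u‖ ^ 2 / 2)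
    refine (this.congr_deriv ?_).congr_of_eventuallyEq ?_
    · field_simp
    · refine Eventually.of_forall fun s => ?_
      simp only [div_eq_mul_inv, mul_inv]; ring
  refine (h1.mul h2.exp).congr_deriv ?_
  rw [Real.rpow_sub_one (by positivity)]
  unfold hk
  field_simp

/-- The dominating Gaussian. -/
def dom (n : ℕ) (t : ℝ) (u : En n) : ℝ := Real.exp (-(1 / (8 * t)) * ‖u‖ ^ 2)

theorem dom_integrable {n : ℕ} {t : ℝ} (ht : 0 < t) : Integrable (dom n t) :=
  gexp_integrable (by positivity)

theorem dom_pos {n : ℕ} {t : ℝ} (u : En n) : 0 < dom n t u := Real.exp_pos _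

theorem dom_le_one {n : ℕ} {t : ℝ} (ht : 0 < t) (u : En n) : |dom n t u| ≤ 1 := by
  rw [abs_of_pos (dom_pos u)]
  unfold dom
  rw [Real.exp_le_one_iff]
  have : 0 ≤ (1 / (8 * t)) * ‖u‖ ^ 2 := by positivity
  linarith

theorem dom_cont {n : ℕ} {t : ℝ} : Continuous (dom n t) := by unfold dom; fun_prop

theorem hk_dom0 {n : ℕ} {t : ℝ} (ht : 0 < t) : ∃ C, 0 < C ∧ ∀ s, t / 2 ≤ s → s ≤ 2 * t →
    ∀ u : En n, (1 + ‖u‖ ^ 2) ^ 2 * hk n s u ≤ C * dom n t u := by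
  obtain ⟨K, hK0, hK⟩ : ∃ K, 0 < K ∧ ∀ r : ℝ, 0 ≤ r → (1 + r) ^ 2 ≤ K * Real.exp (r / (8 * t)) := by
    refine ⟨(1 + 16 * t) ^ 2, by positivity, fun r hr => ?_⟩
    have h1 : 1 + r ≤ (1 + 16 * t) * Real.exp (r / (16 * t)) := by
      have h0 := Real.add_one_le_exp (r / (16 * t))
      have h2 : 1 + r ≤ (1 + 16 * t) * (r / (16 * t) + 1) := by
        have : (1 + 16 * t) * (r / (16 * t) + 1) = r / (16 * t) + r + 1 + 16 * t := by
          field_simp; ring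
        rw [this]
        have : 0 ≤ r / (16 * t) := by positivity
        linarith
      exact h2.trans (mul_le_mul_of_nonneg_left h0 (by positivity))
    calc (1 + r) ^ 2 ≤ ((1 + 16 * t) * Real.exp (r / (16 * t))) ^ 2 :=
          pow_le_pow_left₀ (by positivity) h1 2
      _ = (1 + 16 * t) ^ 2 * Real.exp (r / (8 * t)) := by
          rw [mul_pow, ← Real.exp_nat_mul]
          congr 2; push_cast; field_simp; ring
  refine ⟨K * (π * t) ^ (-(n : ℝ) / 2), by positivity, fun s h1 h2 u => ?_⟩
  have hs : 0 < s := by linarith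
  have e1 : hk n s u ≤ (π * t) ^ (-(n : ℝ) / 2) * Real.exp (-(‖u‖ ^ 2 / (4 * t))) := by
    unfold hk
    apply mul_le_mul
    · apply Real.rpow_le_rpow_of_nonpos (by positivity)
      · nlinarith [Real.pi_pos]
      · have : (0 : ℝ) ≤ n := by positivity
        linarith
    · apply Real.exp_le_exp.2
      rw [neg_div, neg_le_neg_iff]
      exact div_le_div_of_nonneg_left (by positivity) (by positivity) (by linarith)
    · positivity
    · positivity
  calc (1 + ‖u‖ ^ 2) ^ 2 * hk n s u ≤ (K * Real.exp (‖u‖ ^ 2 / (8 * t))) *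
        ((π * t) ^ (-(n : ℝ) / 2) * Real.exp (-(‖u‖ ^ 2 / (4 * t)))) :=
        mul_le_mul (hK _ (by positivity)) e1 (hk_pos hs u).le (by positivity)
    _ = K * (π * t) ^ (-(n : ℝ) / 2) * (Real.exp (‖u‖ ^ 2 / (8 * t)) *
          Real.exp (-(‖u‖ ^ 2 / (4 * t)))) := by ring
    _ = _ := by
        rw [← Real.exp_add]; unfold dom; congr 2; field_simp; norm_num

theorem hk_dom {n : ℕ} {t : ℝ} (ht : 0 < t) : ∃ C, 0 < C ∧ ∀ s, t / 2 ≤ s → s ≤ 2 * t →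
    ∀ u : En n, (1 + ‖u‖ ^ 2) * hk n s u ≤ C * dom n t u ∧
      (1 + ‖u‖ ^ 2) * |dhk n s u| ≤ C * dom n t u := by
  obtain ⟨C, hC, h⟩ := hk_dom0 (n := n) ht
  refine ⟨C * (1 + (n / t + 2 / t ^ 2)), by positivity, fun s h1 h2 u => ?_⟩
  have hs : 0 < s := by linarith
  have hp := hk_pos hs u
  have hd := dom_pos (t := t) u
  have h3 := h s h1 h2 u
  have hu : 0 ≤ ‖u‖ ^ 2 := by positivity
  have hA : 0 ≤ (n / t + 2 / t ^ 2) := by positivity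
  have hCd : 0 < C * dom n t u := by positivity
  constructor
  · have : (1 + ‖u‖ ^ 2) * hk n s u ≤ (1 + ‖u‖ ^ 2) ^ 2 * hk n s u :=
      mul_le_mul_of_nonneg_right (by nlinarith) hp.le
    nlinarith
  · have e : |-(n : ℝ) / (2 * s) + ‖u‖ ^ 2 / (2 * s ^ 2)| ≤
        (n / t + 2 / t ^ 2) * (1 + ‖u‖ ^ 2) := by
      refine (abs_add_le _ _).trans ?_
      have a1 : |-(n : ℝ) / (2 * s)| ≤ n / t := by
        rw [neg_div, abs_neg, abs_of_nonneg (by positivity)]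
        exact div_le_div_of_nonneg_left (by positivity) ht (by linarith)
      have a2 : |‖u‖ ^ 2 / (2 * s ^ 2)| ≤ 2 / t ^ 2 * ‖u‖ ^ 2 := by
        rw [abs_of_nonneg (by positivity)]
        have : 2 / t ^ 2 * ‖u‖ ^ 2 = ‖u‖ ^ 2 / (t ^ 2 / 2) := by field_simp
        rw [this]
        exact div_le_div_of_nonneg_left hu (by positivity) (by nlinarith)
      have : 0 ≤ (n : ℝ) / t := by positivity
      have : 0 ≤ 2 / t ^ 2 := by positivity
      nlinarith
    unfold dhk
    rw [abs_mul, abs_of_pos hp]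
    calc _ ≤ (1 + ‖u‖ ^ 2) * (((n / t + 2 / t ^ 2) * (1 + ‖u‖ ^ 2)) * hk n s u) := by gcongr
      _ = (n / t + 2 / t ^ 2) * ((1 + ‖u‖ ^ 2) ^ 2 * hk n s u) := by ring
      _ ≤ (n / t + 2 / t ^ 2) * (C * dom n t u) := by gcongr
      _ ≤ _ := by nlinarith

theorem hk_lip {n : ℕ} {t C : ℝ} (ht : 0 < t)
    (h : ∀ s, t / 2 ≤ s → s ≤ 2 * t → ∀ u : En n, (1 + ‖u‖ ^ 2) * |dhk n s u| ≤ C * dom n t u)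
    {s s' : ℝ} (hs : s ∈ Set.Icc (t / 2) (2 * t)) (hs' : s' ∈ Set.Icc (t / 2) (2 * t)) (u : En n) :
    (1 + ‖u‖ ^ 2) * |hk n s u - hk n s' u| ≤ C * |s - s'| * dom n t u := by
  have hp : (0 : ℝ) < 1 + ‖u‖ ^ 2 := by positivity
  have := (convex_Icc (t / 2) (2 * t)).norm_image_sub_le_of_norm_hasDerivWithin_le
    (f := fun s => hk n s u) (f' := fun s => dhk n s u) (C := C * dom n t u / (1 + ‖u‖ ^ 2))
    (fun x hx => (hk_hasDerivAt (by linarith [hx.1]) u).hasDerivWithinAt)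
    (fun x hx => by
      rw [Real.norm_eq_abs, le_div_iff₀ hp, mul_comm]; exact h x hx.1 hx.2 u) hs' hs
  rw [Real.norm_eq_abs, Real.norm_eq_abs] at this
  calc _ ≤ (1 + ‖u‖ ^ 2) * (C * dom n t u / (1 + ‖u‖ ^ 2) * |s - s'|) := by gcongr
    _ = _ := by field_simp

section
variable {n d : ℕ} {q : En n → ℝ} {σ : En n → Matrix (Fin d) (Fin d) ℂ}

/-- Unnormalised operator valued density. -/
def Rm (q : En n → ℝ) (σ : En n → Matrix (Fin d) (Fin d) ℂ) (i j : Fin d) (y : En n) : ℂ :=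
  (q y : ℂ) * σ y i j

/-- Weighted integral of the operator valued density. -/
def wint (q : En n → ℝ) (σ : En n → Matrix (Fin d) (Fin d) ℂ) (k : En n → ℝ) :
    Matrix (Fin d) (Fin d) ℂ := Matrix.of fun i j => ∫ y, k y • Rm q σ i j y

/-- Quadratic form of the operator valued density. -/
def qf (σ : En n → Matrix (Fin d) (Fin d) ℂ) (v : Fin d → ℂ) (y : En n) : ℝ :=
  (star v ⬝ᵥ (σ y).mulVec v).re

/-- Admissible weights. -/
def Wt (k : En n → ℝ) : Prop := Continuous k ∧ (∃ B, ∀ y, |k y| ≤ B) ∧ ∀ y, 0 ≤ k y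

theorem cq_int (h : IsCQState q σ) : Integrable q := by
  by_contra hc
  have := integral_undef hc
  rw [h.2.2.1] at this
  exact one_ne_zero this

theorem cq_entry (h : IsCQState q σ) (i j : Fin d) (y : En n) : ‖σ y i j‖ ≤ d := by
  have := posSemidef_entry (h.2.2.2.2 y).1 i j
  rw [(h.2.2.2.2 y).2] at this
  simpa using this

theorem sigma_cont (h : IsCQState q σ) (i j : Fin d) : Continuous fun y => σ y i j :=
  (continuous_apply j).comp ((continuous_apply i).comp h.2.2.2.1)

theorem Rm_le (h : IsCQState q σ) (i j : Fin d) (y : En n) : ‖Rm q σ i j y‖ ≤ d * q y := by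
  unfold Rm
  rw [norm_mul, Complex.norm_real, Real.norm_eq_abs, abs_of_nonneg (h.2.1 y), mul_comm]
  exact mul_le_mul_of_nonneg_right (cq_entry h i j y) (h.2.1 y)

theorem Rm_int (h : IsCQState q σ) (i j : Fin d) : Integrable (Rm q σ i j) := by
  refine ((cq_int h).const_mul d).mono' ?_ (Eventually.of_forall (Rm_le h i j))
  exact (Complex.measurable_ofReal.comp h.1).aestronglyMeasurable.mul
    (sigma_cont h i j).aestronglyMeasurable

theorem Wt.int {F : Type*} [NormedAddCommGroup F] [NormedSpace ℝ F] {k : En n → ℝ} (hk : Wt k)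
    {f : En n → F} (hf : Integrable f) : Integrable fun y => k y • f y := by
  obtain ⟨h1, ⟨B, hB⟩, -⟩ := hk
  exact hf.bdd_smul B h1.aestronglyMeasurable (Eventually.of_forall hB)

theorem qf_nonneg (h : IsCQState q σ) (v : Fin d → ℂ) (y : En n) : 0 ≤ qf σ v y :=
  (Complex.le_def.1 ((h.2.2.2.2 y).1.dotProduct_mulVec_nonneg v)).1

theorem qf_eq (h : IsCQState q σ) (v : Fin d → ℂ) (y : En n) :
    star v ⬝ᵥ (σ y).mulVec v = (qf σ v y : ℂ) := by
  have := (Complex.le_def.1 ((h.2.2.2.2 y).1.dotProduct_mulVec_nonneg v)).2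
  apply Complex.ext
  · simp [qf]
  · simpa using this.symm

theorem quad_sum (A : Matrix (Fin d) (Fin d) ℂ) (v : Fin d → ℂ) :
    star v ⬝ᵥ A.mulVec v = ∑ i, ∑ j, (star (v i) * v j) * A i j := by
  simp only [dotProduct, Matrix.mulVec, Finset.mul_sum]
  refine Finset.sum_congr rfl fun i _ => Finset.sum_congr rfl fun j _ => ?_
  simp; ring

theorem wint_quad (h : IsCQState q σ) {k : En n → ℝ} (hk : Wt k) (v : Fin d → ℂ) :
    star v ⬝ᵥ (wint q σ k).mulVec v = ((∫ y, k y * (q y * qf σ v y) : ℝ) : ℂ) := by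
  rw [quad_sum]
  have hi : ∀ i j, Integrable fun y => k y • Rm q σ i j y := fun i j => hk.int (Rm_int h i j)
  simp only [wint, Matrix.of_apply]
  simp_rw [← integral_const_mul]
  simp_rw [← integral_finsetSum Finset.univ (fun j _ => (hi _ j).const_mul _)]
  rw [← integral_finsetSum Finset.univ
    (fun i _ => integrable_finsetSum _ fun j _ => (hi i j).const_mul _), ← integral_complex_ofReal]
  refine integral_congr_ae (Eventually.of_forall fun y => ?_)
  simp only [Complex.ofReal_mul]
  rw [← qf_eq h, quad_sum]
  simp only [Finset.mul_sum, Rm, Complex.real_smul]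
  refine Finset.sum_congr rfl fun i _ => Finset.sum_congr rfl fun j _ => ?_
  ring

theorem qf_int (h : IsCQState q σ) {k : En n → ℝ} (hk : Wt k) (v : Fin d → ℂ) :
    Integrable fun y => k y * (q y * qf σ v y) := by
  have hi : ∀ i j, Integrable fun y => k y • Rm q σ i j y := fun i j => hk.int (Rm_int h i j)
  have : Integrable fun y => ∑ i, ∑ j, (star (v i) * v j) * (k y • Rm q σ i j y) :=
    integrable_finsetSum _ fun i _ => integrable_finsetSum _ fun j _ => (hi i j).const_mul _
  refine this.re.congr (Eventually.of_forall fun y => ?_)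
  have e : ∑ i, ∑ j, (star (v i) * v j) * (k y • Rm q σ i j y) =
      ((k y * (q y * qf σ v y) : ℝ) : ℂ) := by
    simp only [Complex.ofReal_mul]
    rw [← qf_eq h, quad_sum]
    simp only [Finset.mul_sum, Rm, Complex.real_smul]
    refine Finset.sum_congr rfl fun i _ => Finset.sum_congr rfl fun j _ => ?_
    ring
  simp only [e]
  simp

theorem wint_trace (h : IsCQState q σ) {k : En n → ℝ} (hk : Wt k) :
    (wint q σ k).trace = ((∫ y, k y * q y : ℝ) : ℂ) := by
  simp only [Matrix.trace, Matrix.diag, wint, Matrix.of_apply]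
  rw [← integral_finsetSum Finset.univ fun i _ => hk.int (Rm_int h i i), ← integral_complex_ofReal]
  refine integral_congr_ae (Eventually.of_forall fun y => ?_)
  have := (h.2.2.2.2 y).2
  simp only [Matrix.trace, Matrix.diag] at this
  simp only [Rm, Complex.real_smul, ← Finset.mul_sum, this]
  simp

theorem wint_psd (h : IsCQState q σ) {k : En n → ℝ} (hk : Wt k) : (wint q σ k).PosSemidef := by
  refine Matrix.PosSemidef.of_dotProduct_mulVec_nonneg ?_ ?_
  · ext i j
    simp only [Matrix.conjTranspose_apply, wint, Matrix.of_apply]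
    rw [← starRingEnd_apply, ← integral_conj]
    refine integral_congr_ae (Eventually.of_forall fun y => ?_)
    have := (h.2.2.2.2 y).1.1.apply i j
    simp only [Rm, Complex.real_smul, map_mul, Complex.conj_ofReal]
    rw [← this]; simp
  · intro v
    rw [wint_quad h hk]
    rw [Complex.zero_le_real]
    exact integral_nonneg fun y => mul_nonneg (hk.2.2 y) (mul_nonneg (h.2.1 y) (qf_nonneg h v y))

theorem wint_mono (h : IsCQState q σ) {k k' : En n → ℝ} (hk : Wt k) (hk' : Wt k') {c : ℝ}
    (hc : ∀ y, c * k y ≤ k' y) (v : Fin d → ℂ) :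
    c * (star v ⬝ᵥ (wint q σ k).mulVec v).re ≤ (star v ⬝ᵥ (wint q σ k').mulVec v).re := by
  rw [wint_quad h hk, wint_quad h hk', Complex.ofReal_re, Complex.ofReal_re, ← integral_const_mul]
  refine integral_mono ((qf_int h hk v).const_mul c) (qf_int h hk' v) fun y => ?_
  have := mul_le_mul_of_nonneg_right (hc y) (mul_nonneg (h.2.1 y) (qf_nonneg h v y))
  simpa [mul_assoc] using this

theorem wint_ker (h : IsCQState q σ) {k k' : En n → ℝ} (hk : Wt k) (hk' : Wt k')
    (hp : ∀ y, 0 < k y) (v : Fin d → ℂ) (hv : (wint q σ k).mulVec v = 0) :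
    (wint q σ k').mulVec v = 0 := by
  rw [← (wint_psd h hk').dotProduct_mulVec_zero_iff, wint_quad h hk']
  rw [← (wint_psd h hk).dotProduct_mulVec_zero_iff, wint_quad h hk, Complex.ofReal_eq_zero,
    integral_eq_zero_iff_of_nonneg
      (fun y => mul_nonneg (hk.2.2 y) (mul_nonneg (h.2.1 y) (qf_nonneg h v y))) (qf_int h hk v)] at hv
  rw [Complex.ofReal_eq_zero]
  apply integral_eq_zero_of_ae
  filter_upwards [hv] with y hy
  have := (mul_eq_zero.1 hy).resolve_left (hp y).ne'
  simp [this]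

theorem wt_hk {s : ℝ} (hs : 0 < s) (x : En n) : Wt fun y => hk n s (x - y) :=
  ⟨(hk_cont s).comp (continuous_const.sub continuous_id), ⟨_, fun _ => hk_abs_le hs _⟩,
    fun _ => (hk_pos hs _).le⟩

theorem wt_gexp {b : ℝ} (hb : 0 < b) : Wt fun y : En n => Real.exp (-b * ‖y‖ ^ 2) := by
  refine ⟨by fun_prop, ⟨1, fun y => ?_⟩, fun _ => (Real.exp_pos _).le⟩
  rw [abs_of_pos (Real.exp_pos _), Real.exp_le_one_iff]
  have : 0 ≤ b * ‖y‖ ^ 2 := by positivity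
  linarith

theorem wint_pos (h : IsCQState q σ) {k : En n → ℝ} (hk : Wt k) (hp : ∀ y, 0 < k y) :
    0 < ∫ y, k y * q y := by
  have hi := hk.int (cq_int h)
  simp only [smul_eq_mul] at hi
  rw [integral_pos_iff_support_of_nonneg (fun y => mul_nonneg (hk.2.2 y) (h.2.1 y)) hi]
  have : Function.support (fun y => k y * q y) = Function.support q := by
    ext y; simp [(hp y).ne']
  rw [this, ← integral_pos_iff_support_of_nonneg h.2.1 (cq_int h), h.2.2.1]
  exact one_pos

/-- The evolved operator valued density. -/
def Hm (q : En n → ℝ) (σ : En n → Matrix (Fin d) (Fin d) ℂ) (s : ℝ) (x : En n) :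
    Matrix (Fin d) (Fin d) ℂ := wint q σ fun y => hk n s (x - y)

theorem Hm_apply (s : ℝ) (x : En n) (i j : Fin d) :
    Hm q σ s x i j = hflow s (Rm q σ i j) x := rfl

theorem Hm_psd (h : IsCQState q σ) {s : ℝ} (hs : 0 < s) (x : En n) : (Hm q σ s x).PosSemidef :=
  wint_psd h (wt_hk hs x)

theorem hp_pos (h : IsCQState q σ) {s : ℝ} (hs : 0 < s) (x : En n) : 0 < hflow s q x :=
  wint_pos h (wt_hk hs x) fun _ => hk_pos hs _

theorem Hm_trace (h : IsCQState q σ) {s : ℝ} (hs : 0 < s) (x : En n) :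
    (Hm q σ s x).trace = ((hflow s q x : ℝ) : ℂ) := wint_trace h (wt_hk hs x)

theorem Hm_ker (h : IsCQState q σ) {s s' : ℝ} (hs : 0 < s) (hs' : 0 < s') (x : En n)
    (v : Fin d → ℂ) : (Hm q σ s x).mulVec v = 0 ↔ (Hm q σ s' x).mulVec v = 0 :=
  ⟨wint_ker h (wt_hk hs x) (wt_hk hs' x) (fun _ => hk_pos hs _) v,
   wint_ker h (wt_hk hs' x) (wt_hk hs x) (fun _ => hk_pos hs' _) v⟩

theorem hk_lower {t s : ℝ} (ht : 0 < t) (h1 : t / 2 ≤ s) (h2 : s ≤ 2 * t) (x y : En n) :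
    (4 * π * t) ^ (-(n : ℝ) / 2) * Real.exp (-(2 / t) * ‖x‖ ^ 2) * Real.exp (-(2 / t) * ‖y‖ ^ 2) ≤
      hk n s (x - y) := by
  have hs : 0 < s := by linarith
  unfold hk
  rw [mul_assoc, ← Real.exp_add]
  apply mul_le_mul
  · apply Real.rpow_le_rpow_of_nonpos (by positivity)
    · nlinarith [Real.pi_pos]
    · have : (0 : ℝ) ≤ n := by positivity
      linarith
  · apply Real.exp_le_exp.2
    have e : ‖x - y‖ ^ 2 ≤ 2 * (‖x‖ ^ 2 + ‖y‖ ^ 2) := by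
      have a := norm_sub_le x y
      have b := norm_nonneg (x - y)
      nlinarith [sq_nonneg (‖x‖ - ‖y‖)]
    have e2 : ‖x - y‖ ^ 2 / (2 * s) ≤ (2 * (‖x‖ ^ 2 + ‖y‖ ^ 2)) / t :=
      div_le_div₀ (by positivity) e ht (by linarith)
    have e3 : (2 * (‖x‖ ^ 2 + ‖y‖ ^ 2)) / t = (2 / t) * ‖x‖ ^ 2 + (2 / t) * ‖y‖ ^ 2 := by
      field_simp
    rw [neg_div]
    linarith
  · positivity
  · positivity

theorem hp_le (h : IsCQState q σ) {t s : ℝ} (ht : 0 < t) (h1 : t / 2 ≤ s) (x : En n) :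
    hflow s q x ≤ (π * t) ^ (-(n : ℝ) / 2) := by
  have hs : 0 < s := by linarith
  have : ∫ y, (π * t) ^ (-(n : ℝ) / 2) * q y = (π * t) ^ (-(n : ℝ) / 2) := by
    rw [integral_const_mul, h.2.2.1, mul_one]
  rw [← this]
  refine integral_mono (hflow_pt hs (cq_int h) x) ((cq_int h).const_mul _) fun y => ?_
  refine mul_le_mul_of_nonneg_right ((hk_le hs _).trans ?_) (h.2.1 y)
  apply Real.rpow_le_rpow_of_nonpos (by positivity)
  · nlinarith [Real.pi_pos]
  · have : (0 : ℝ) ≤ n := by positivity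
    linarith

/-- Uniform two sided bounds on the nonzero spectrum. -/
theorem spec_bound (h : IsCQState q σ) {t : ℝ} (ht : 0 < t) :
    ∃ a, 0 < a ∧ ∀ s, t / 2 ≤ s → s ≤ 2 * t → ∀ x : En n, ∀ hH : (Hm q σ s x).PosSemidef,
      (∀ i, hH.1.eigenvalues i = 0 ∨ (a * Real.exp (-(2 / t) * ‖x‖ ^ 2) ≤ hH.1.eigenvalues i ∧
        hH.1.eigenvalues i ≤ (π * t) ^ (-(n : ℝ) / 2))) ∧
      a * Real.exp (-(2 / t) * ‖x‖ ^ 2) ≤ hflow s q x := by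
  have hw := wt_gexp (n := n) (b := 2 / t) (by positivity)
  obtain ⟨w0, hw0, hW⟩ := eig_lower (wint_psd h hw)
  have hI := wint_pos h hw fun y => Real.exp_pos _
  set I := ∫ y, Real.exp (-(2 / t) * ‖y‖ ^ 2) * q y with hIdef
  have hK : 0 < (4 * π * t) ^ (-(n : ℝ) / 2) := by positivity
  set K := (4 * π * t) ^ (-(n : ℝ) / 2) with hKdef
  refine ⟨K * min w0 I, by positivity, fun s h1 h2 x hH => ?_⟩
  have hs : 0 < s := by linarith
  have hE := Real.exp_pos (-(2 / t) * ‖x‖ ^ 2)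
  refine ⟨fun i => ?_, ?_⟩
  · rcases hW _ hH (K * Real.exp (-(2 / t) * ‖x‖ ^ 2)) (by positivity)
      (fun v hv => wint_ker h hw (wt_hk hs x) (fun y => Real.exp_pos _) v hv)
      (fun v => wint_mono h hw (wt_hk hs x) (fun y => hk_lower ht h1 h2 x y) v) i with h0 | h0
    · exact Or.inl h0
    · refine Or.inr ⟨le_trans ?_ h0, ?_⟩
      · have := min_le_left w0 I
        calc _ ≤ K * w0 * Real.exp (-(2 / t) * ‖x‖ ^ 2) := by gcongr
          _ = _ := by ring
      · have := eig_le_trace hH i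
        rw [Hm_trace h hs, Complex.ofReal_re] at this
        exact this.trans (hp_le h ht h1 x)
  · have := min_le_right w0 I
    calc _ ≤ K * I * Real.exp (-(2 / t) * ‖x‖ ^ 2) := by gcongr
      _ = ∫ y, (K * Real.exp (-(2 / t) * ‖x‖ ^ 2)) * (Real.exp (-(2 / t) * ‖y‖ ^ 2) * q y) := by
          rw [integral_const_mul]; ring
      _ ≤ _ := by
          refine integral_mono ((hw.int (cq_int h)).const_mul _) (hflow_pt hs (cq_int h) x)
            fun y => ?_
          have := mul_le_mul_of_nonneg_right (hk_lower ht h1 h2 x y) (h.2.1 y)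
          rw [← hKdef] at this
          simpa [mul_assoc] using this

theorem log_bd {a b t l r : ℝ} (ha : 0 < a) (hr : 0 ≤ r) (ht : 0 < t)
    (h1 : a * Real.exp (-(2 / t) * r) ≤ l) (h2 : l ≤ b) :
    |Real.log l| ≤ (|Real.log a| + |Real.log b| + 2 / t) * (1 + r) := by
  have hl : 0 < l := lt_of_lt_of_le (by positivity) h1
  have e1 := Real.log_le_log (by positivity) h1
  have e2 := Real.log_le_log hl h2
  rw [Real.log_mul ha.ne' (Real.exp_pos _).ne', Real.log_exp] at e1
  have h3 : 0 ≤ 2 / t := by positivity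
  have := abs_nonneg (Real.log a)
  have := abs_nonneg (Real.log b)
  have := neg_abs_le (Real.log a)
  have := le_abs_self (Real.log b)
  rw [abs_le]
  constructor <;> nlinarith [mul_nonneg h3 hr, mul_nonneg (abs_nonneg (Real.log a)) hr, mul_nonneg (abs_nonneg (Real.log b)) hr]

theorem log_spec (h : IsCQState q σ) {t : ℝ} (ht : 0 < t) :
    ∃ L, 0 < L ∧ ∀ s, t / 2 ≤ s → s ≤ 2 * t → ∀ x : En n, ∀ hH : (Hm q σ s x).PosSemidef,
      (∀ i, |Real.log (hH.1.eigenvalues i)| ≤ L * (1 + ‖x‖ ^ 2)) ∧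
      |Real.log (hflow s q x)| ≤ L * (1 + ‖x‖ ^ 2) := by
  obtain ⟨a, ha, hb⟩ := spec_bound h ht
  refine ⟨|Real.log a| + |Real.log ((π * t) ^ (-(n : ℝ) / 2))| + 2 / t, by positivity,
    fun s h1 h2 x hH => ⟨fun i => ?_, ?_⟩⟩
  · rcases (hb s h1 h2 x hH).1 i with h0 | h0
    · rw [h0, Real.log_zero, abs_zero]; positivity
    · exact log_bd ha (by positivity) ht h0.1 h0.2
  · exact log_bd ha (by positivity) ht (hb s h1 h2 x hH).2 (hp_le h ht h1 x)
end

section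
variable {n d : ℕ} {q : En n → ℝ} {σ : En n → Matrix (Fin d) (Fin d) ℂ}

/-- The dominating function in space. -/
def mdom (q : En n → ℝ) (t : ℝ) (x : En n) : ℝ :=
  ∫ y, dom n t (x - y) • ((1 + ‖y‖ ^ 2) * q y)

theorem q2_int (h : IsCQState q σ) (hX : Integrable fun x : En n => ‖x‖ ^ 2 * q x) :
    Integrable fun y : En n => (1 + ‖y‖ ^ 2) * q y :=
  ((cq_int h).add hX).congr (Eventually.of_forall fun y => by simp; ring)

theorem mdom_int (h : IsCQState q σ) (hX : Integrable fun x : En n => ‖x‖ ^ 2 * q x) {t : ℝ}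
    (ht : 0 < t) : Integrable (mdom q t) :=
  ker_conv_integrable (dom_integrable ht) (q2_int h hX)

theorem mdom_nonneg (h : IsCQState q σ) (t : ℝ) (x : En n) : 0 ≤ mdom q t x :=
  integral_nonneg fun y => mul_nonneg (dom_pos _).le (mul_nonneg (by positivity) (h.2.1 y))

theorem ker_bound (h : IsCQState q σ) (hX : Integrable fun x : En n => ‖x‖ ^ 2 * q x) {t : ℝ}
    (ht : 0 < t) {F : Type*} [NormedAddCommGroup F] [NormedSpace ℝ F] {f : En n → F} {D : ℝ}
    (hD : 0 ≤ D) (hf : ∀ y, ‖f y‖ ≤ D * q y) {k : En n → ℝ} {C : ℝ}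
    (hk : ∀ u, (1 + ‖u‖ ^ 2) * |k u| ≤ C * dom n t u) (x : En n) :
    (1 + ‖x‖ ^ 2) * ‖∫ y, k (x - y) • f y‖ ≤ 2 * C * D * mdom q t x := by
  have hp : (0 : ℝ) < 1 + ‖x‖ ^ 2 := by positivity
  have hi := (ker_integrable (dom_cont (n := n) (t := t)) (dom_le_one ht) (q2_int h hX) x).const_mul
    (2 * C * D / (1 + ‖x‖ ^ 2))
  have := norm_integral_le_of_norm_le (f := fun y => k (x - y) • f y) hi
    (Eventually.of_forall fun y => ?_)
  · rw [integral_const_mul] at this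
    calc _ ≤ (1 + ‖x‖ ^ 2) * (2 * C * D / (1 + ‖x‖ ^ 2) * mdom q t x) := by
          gcongr; exact this
      _ = _ := by field_simp
  · rw [norm_smul, Real.norm_eq_abs, div_mul_eq_mul_div, le_div_iff₀ hp, smul_eq_mul]
    have e : 1 + ‖x‖ ^ 2 ≤ 2 * (1 + ‖x - y‖ ^ 2) * (1 + ‖y‖ ^ 2) := by
      have a : ‖x‖ ≤ ‖x - y‖ + ‖y‖ := by simpa using norm_add_le (x - y) y
      have b := norm_nonneg x
      nlinarith [sq_nonneg (‖x - y‖ - ‖y‖), mul_nonneg (sq_nonneg ‖x - y‖) (sq_nonneg ‖y‖)]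
    have hq := h.2.1 y
    calc |k (x - y)| * ‖f y‖ * (1 + ‖x‖ ^ 2)
        ≤ |k (x - y)| * (D * q y) * (2 * (1 + ‖x - y‖ ^ 2) * (1 + ‖y‖ ^ 2)) := by
          have := hf y
          gcongr
      _ = ((1 + ‖x - y‖ ^ 2) * |k (x - y)|) * (2 * D * (1 + ‖y‖ ^ 2) * q y) := by ring
      _ ≤ (C * dom n t (x - y)) * (2 * D * (1 + ‖y‖ ^ 2) * q y) := by
          have := hk (x - y)
          gcongr
      _ = _ := by ring

theorem Hm_continuous (h : IsCQState q σ) {s : ℝ} (hs : 0 < s) : Continuous (Hm q σ s) := by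
  refine continuous_pi fun i => continuous_pi fun j => ?_
  exact hflow_continuous hs (Rm_int h i j)

theorem vnEnt_Hm_cont (h : IsCQState q σ) {s : ℝ} (hs : 0 < s) :
    Continuous fun x => vnEnt (Hm q σ s x) :=
  continuous_vnEnt (Hm_continuous h hs) (Hm_psd h hs)

theorem vnEnt_abs_le {A : Matrix (Fin d) (Fin d) ℂ} (hA : A.PosSemidef) {Λ : ℝ}
    (hl : ∀ i, |Real.log (hA.1.eigenvalues i)| ≤ Λ) : |vnEnt A| ≤ Λ * A.trace.re := by
  rw [vnEnt_eq hA.1, hA.1.trace_eq_sum_eigenvalues]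
  simp only [Complex.re_sum, Complex.coe_algebraMap, Finset.mul_sum]
  refine (Finset.abs_sum_le_sum_abs _ _).trans (Finset.sum_le_sum fun i _ => ?_)
  have h0 := hA.eigenvalues_nonneg i
  rw [negMulLog, abs_mul, abs_neg, abs_of_nonneg h0, mul_comm]
  exact mul_le_mul_of_nonneg_right (hl i) h0

theorem nhd {t : ℝ} (ht : 0 < t) : Set.Icc (t / 2) (2 * t) ∈ 𝓝 t :=
  Icc_mem_nhds (by linarith) (by linarith)

theorem hp2_le (h : IsCQState q σ) (hX : Integrable fun x : En n => ‖x‖ ^ 2 * q x) {t : ℝ}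
    (ht : 0 < t) : ∃ C, 0 < C ∧ ∀ x, (1 + ‖x‖ ^ 2) * hflow t q x ≤ C * mdom q t x := by
  obtain ⟨C, hC, hb⟩ := hk_dom (n := n) ht
  refine ⟨2 * C * 1, by positivity, fun x => ?_⟩
  have := ker_bound h hX ht (f := q) (D := 1) zero_le_one
    (fun y => by rw [Real.norm_eq_abs, abs_of_nonneg (h.2.1 y), one_mul]) (k := hk n t) (C := C)
    (fun u => by rw [abs_of_pos (hk_pos ht u)]; exact (hb t (by linarith) (by linarith) u).1) x
  refine le_trans ?_ this
  gcongr
  exact le_abs_self _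

theorem vnEnt_Hm_int (h : IsCQState q σ) (hX : Integrable fun x : En n => ‖x‖ ^ 2 * q x) {t : ℝ}
    (ht : 0 < t) : Integrable fun x => vnEnt (Hm q σ t x) := by
  obtain ⟨C, hC, hb⟩ := hp2_le h hX ht
  obtain ⟨L, hL, hl⟩ := log_spec h ht
  refine ((mdom_int h hX ht).const_mul (L * C)).mono' (vnEnt_Hm_cont h ht).aestronglyMeasurable
    (Eventually.of_forall fun x => ?_)
  have h1 := vnEnt_abs_le (Hm_psd h ht x) (hl t (by linarith) (by linarith) x (Hm_psd h ht x)).1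
  rw [Hm_trace h ht, Complex.ofReal_re] at h1
  rw [Real.norm_eq_abs]
  have := hb x
  calc _ ≤ _ := h1
    _ = L * ((1 + ‖x‖ ^ 2) * hflow t q x) := by ring
    _ ≤ L * (C * mdom q t x) := by gcongr
    _ = _ := by ring

theorem hplog_int (h : IsCQState q σ) (hX : Integrable fun x : En n => ‖x‖ ^ 2 * q x) {t : ℝ}
    (ht : 0 < t) : Integrable fun x => hflow t q x * Real.log (hflow t q x) := by
  obtain ⟨C, hC, hb⟩ := hp2_le h hX ht
  obtain ⟨L, hL, hl⟩ := log_spec h ht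
  have hc := hflow_continuous ht (cq_int h)
  refine ((mdom_int h hX ht).const_mul (L * C)).mono'
    (hc.mul (hc.log fun x => (hp_pos h ht x).ne')).aestronglyMeasurable
    (Eventually.of_forall fun x => ?_)
  have h1 := (hl t (by linarith) (by linarith) x (Hm_psd h ht x)).2
  have hp := hp_pos h ht x
  rw [Real.norm_eq_abs, abs_mul, abs_of_pos hp]
  have := hb x
  calc _ ≤ hflow t q x * (L * (1 + ‖x‖ ^ 2)) := by gcongr
    _ = L * ((1 + ‖x‖ ^ 2) * hflow t q x) := by ring
    _ ≤ L * (C * mdom q t x) := by gcongr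
    _ = _ := by ring

theorem Hm_entry_deriv (h : IsCQState q σ) {t : ℝ} (ht : 0 < t) (x : En n) (i j : Fin d) :
    HasDerivAt (fun s => Hm q σ s x i j) (∫ y, dhk n t (x - y) • Rm q σ i j y) t := by
  obtain ⟨C, hC, hb⟩ := hk_dom (n := n) ht
  have hR := Rm_int h i j
  refine (hasDerivAt_integral_of_dominated_loc_of_deriv_le (nhd ht)
    (F := fun s y => hk n s (x - y) • Rm q σ i j y)
    (F' := fun s y => dhk n s (x - y) • Rm q σ i j y)
    (bound := fun y => C * ‖Rm q σ i j y‖) ?_ (hflow_pt ht hR x) ?_ ?_ (hR.norm.const_mul C) ?_).2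
  · filter_upwards [nhd ht] with s hs
    exact (hflow_pt (by linarith [hs.1]) hR x).aestronglyMeasurable
  · have : Continuous fun y : En n => dhk n t (x - y) := by unfold dhk hk; fun_prop
    exact this.aestronglyMeasurable.smul hR.aestronglyMeasurable
  · refine Eventually.of_forall fun y s hs => ?_
    rw [norm_smul]
    refine mul_le_mul_of_nonneg_right ?_ (norm_nonneg _)
    have h1 := (hb s hs.1 hs.2 (x - y)).2
    have h2 := dom_le_one ht (x - y)
    rw [abs_of_pos (dom_pos _)] at h2
    rw [Real.norm_eq_abs]
    have h3 := abs_nonneg (dhk n s (x - y))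
    nlinarith [mul_nonneg (sq_nonneg ‖x - y‖) h3]
  · refine Eventually.of_forall fun y s hs => ?_
    exact (hk_hasDerivAt (by linarith [hs.1]) (x - y)).smul_const _

theorem vn_pt_deriv (h : IsCQState q σ) {t : ℝ} (ht : 0 < t) (x : En n) :
    ∃ D, HasDerivAt (fun s => vnEnt (Hm q σ s x)) D t := by
  obtain ⟨a, ha, hb⟩ := spec_bound h ht
  have hp : ∀ s ∈ Set.Icc (t / 2) (2 * t), (Hm q σ s x).PosSemidef :=
    fun s hs => Hm_psd h (by linarith [hs.1]) x
  exact vn_deriv (A := fun s => Hm q σ s x)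
    (A' := Matrix.of fun i j => ∫ y, dhk n t (x - y) • Rm q σ i j y)
    (nhd ht) hp
    (fun s hs v => Hm_ker h (by linarith [hs.1]) ht x v)
    (a := a * Real.exp (-(2 / t) * ‖x‖ ^ 2)) (by positivity)
    (fun s hs i => (hb s hs.1 hs.2 x (hp s hs)).1 i)
    (fun i j => Hm_entry_deriv h ht x i j)

theorem vn_pt_lip (h : IsCQState q σ) (hX : Integrable fun x : En n => ‖x‖ ^ 2 * q x) {t : ℝ}
    (ht : 0 < t) : ∃ K, 0 ≤ K ∧ ∀ x, ∀ s ∈ Set.Icc (t / 2) (2 * t), ∀ s' ∈ Set.Icc (t / 2) (2 * t),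
      |vnEnt (Hm q σ s x) - vnEnt (Hm q σ s' x)| ≤ K * mdom q t x * |s - s'| := by
  obtain ⟨C, hC, hb⟩ := hk_dom (n := n) ht
  obtain ⟨L, hL, hl⟩ := log_spec h ht
  refine ⟨d * (d * (2 * C * d * (d * L))) + d * (2 * C * d), by positivity,
    fun x s hs s' hs' => ?_⟩
  have hs0 : 0 < s := by linarith [hs.1]
  have hs0' : 0 < s' := by linarith [hs'.1]
  have hp : (0 : ℝ) < 1 + ‖x‖ ^ 2 := by positivity
  have hm := mdom_nonneg h t x
  set δ := 2 * C * |s - s'| * d * mdom q t x / (1 + ‖x‖ ^ 2) with hδ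
  have hδ1 : δ * (1 + ‖x‖ ^ 2) = 2 * C * |s - s'| * d * mdom q t x := by
    rw [hδ]; field_simp
  have hδ0 : 0 ≤ δ := by positivity
  have hδ2 : δ ≤ 2 * C * |s - s'| * d * mdom q t x := by
    rw [← hδ1]; nlinarith [sq_nonneg ‖x‖]
  have := vn_lip (Hm_psd h hs0 x) (Hm_psd h hs0' x) (fun v => Hm_ker h hs0' hs0 x v)
    (Λ := L * (1 + ‖x‖ ^ 2)) (δ := δ) (by positivity) (hl s hs.1 hs.2 x (Hm_psd h hs0 x)).1
    (hl s' hs'.1 hs'.2 x (Hm_psd h hs0' x)).1 ?_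
  · refine this.trans ?_
    calc d * (d * (δ * (d * (L * (1 + ‖x‖ ^ 2))))) + d * δ
        = d * (d * ((δ * (1 + ‖x‖ ^ 2)) * (d * L))) + d * δ := by ring
      _ ≤ d * (d * ((2 * C * |s - s'| * d * mdom q t x) * (d * L))) +
          d * (2 * C * |s - s'| * d * mdom q t x) := by
          rw [hδ1]; gcongr
      _ = _ := by ring
  · intro i j
    rw [hδ, le_div_iff₀ hp, mul_comm]
    have e : Hm q σ s x i j - Hm q σ s' x i j =
        ∫ y, (fun u => hk n s u - hk n s' u) (x - y) • Rm q σ i j y := by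
      rw [Hm_apply, Hm_apply]
      unfold hflow
      rw [← integral_sub (hflow_pt hs0 (Rm_int h i j) x) (hflow_pt hs0' (Rm_int h i j) x)]
      simp only [sub_smul]
    rw [e]
    have := ker_bound h hX ht (f := Rm q σ i j) (D := d) (by positivity) (Rm_le h i j)
      (k := fun u => hk n s u - hk n s' u) (C := C * |s - s'|)
      (fun u => hk_lip ht (fun s h1 h2 u => (hb s h1 h2 u).2) hs hs' u) x
    refine this.trans (le_of_eq ?_)
    ring

/-- The integrated unnormalised entropy. -/
def Phi (q : En n → ℝ) (σ : En n → Matrix (Fin d) (Fin d) ℂ) (s : ℝ) : ℝ :=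
  ∫ x, vnEnt (Hm q σ s x)

theorem Phi_deriv (h : IsCQState q σ) (hX : Integrable fun x : En n => ‖x‖ ^ 2 * q x) {t : ℝ}
    (ht : 0 < t) : ∃ D, HasDerivAt (Phi q σ) D t := by
  obtain ⟨K, hK, hlip⟩ := vn_pt_lip h hX ht
  choose D hD using fun x => vn_pt_deriv h ht x
  refine ⟨∫ x, D x, (hasDerivAt_integral_of_dominated_loc_of_lip (nhd ht)
    (F := fun s x => vnEnt (Hm q σ s x)) (bound := fun x => K * mdom q t x) ?_
    (vnEnt_Hm_int h hX ht) ?_ ?_ ((mdom_int h hX ht).const_mul K) (Eventually.of_forall hD)).2⟩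
  · filter_upwards [nhd ht] with s hs
    exact (vnEnt_Hm_cont h (by linarith [hs.1])).aestronglyMeasurable
  · have hseq : Tendsto (fun k : ℕ => t + 1 / ((k : ℝ) + 1)) atTop (𝓝[≠] t) := by
      rw [tendsto_nhdsWithin_iff]
      refine ⟨?_, Eventually.of_forall fun k => ?_⟩
      · simpa using tendsto_const_nhds.add (tendsto_one_div_add_atTop_nhds_zero_nat (𝕜 := ℝ))
      · have : (0 : ℝ) < 1 / ((k : ℝ) + 1) := by positivity
        simp only [Set.mem_compl_iff, Set.mem_singleton_iff]
        linarith
    refine aestronglyMeasurable_of_tendsto_ae atTop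
      (f := fun (k : ℕ) x => slope (fun s => vnEnt (Hm q σ s x)) t (t + 1 / ((k : ℝ) + 1)))
      (fun k => ?_) (Eventually.of_forall fun x =>
        (hasDerivAt_iff_tendsto_slope.1 (hD x)).comp hseq)
    simp only [slope_def_module]
    have h0 : 0 < t + 1 / ((k : ℝ) + 1) := by positivity
    exact (((vnEnt_Hm_cont h h0).sub (vnEnt_Hm_cont h ht)).const_smul
      ((t + 1 / ((k : ℝ) + 1) - t)⁻¹ : ℝ)).aestronglyMeasurable
  · refine Eventually.of_forall fun x => ?_
    refine LipschitzOnWith.of_dist_le_mul fun s hs s' hs' => ?_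
    rw [Real.dist_eq, Real.dist_eq]
    have h0 : 0 ≤ K * mdom q t x := mul_nonneg hK (mdom_nonneg h t x)
    simp only [Real.coe_nnabs, abs_of_nonneg h0]
    exact hlip x s hs s' hs'
end

section
variable {n d : ℕ} {q : En n → ℝ} {σ : En n → Matrix (Fin d) (Fin d) ℂ}

/-- Evolved normalised state. -/
def sg (q : En n → ℝ) (σ : En n → Matrix (Fin d) (Fin d) ℂ) (t : ℝ) (x : En n) :
    Matrix (Fin d) (Fin d) ℂ := ((hflow t q x : ℝ) : ℂ)⁻¹ • Hm q σ t x

theorem margFst_eq {t : ℝ} (ht : 0 < t) (q : En n → ℝ) :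
    margFst (noisyDensity (√t) q) = hflow t q := by
  funext x
  exact gauss_to_hk ht q x

theorem margFstState_eq {t : ℝ} (ht : 0 < t) (q : En n → ℝ)
    (σ : En n → Matrix (Fin d) (Fin d) ℂ) :
    margFstState (noisyDensity (√t) q) (noisyState (√t) σ) = sg q σ t := by
  funext x
  unfold margFstState sg
  rw [margFst_eq ht]
  congr 1
  ext i j
  rw [Matrix.of_apply, Hm_apply]
  have := gauss_to_hk ht (Rm q σ i j) x
  unfold hflow
  rw [← this]
  refine integral_congr_ae (Eventually.of_forall fun z => ?_)
  simp only [noisyDensity, noisyState, Rm, Complex.real_smul, Complex.ofReal_mul]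
  ring

theorem Rm_sg (h : IsCQState q σ) {t : ℝ} (ht : 0 < t) (i j : Fin d) :
    Rm (hflow t q) (sg q σ t) i j = hflow t (Rm q σ i j) := by
  funext x
  unfold Rm sg
  have : ((hflow t q x : ℝ) : ℂ) ≠ 0 := by exact_mod_cast (hp_pos h ht x).ne'
  rw [Matrix.smul_apply, smul_eq_mul, mul_inv_cancel_left₀ this]
  rfl

theorem cq_flow (h : IsCQState q σ) {t : ℝ} (ht : 0 < t) :
    IsCQState (hflow t q) (sg q σ t) := by
  have hc := hflow_continuous ht (cq_int h)
  refine ⟨hc.measurable, fun x => (hp_pos h ht x).le, ?_, ?_, fun x => ⟨?_, ?_⟩⟩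
  · rw [hflow_integral ht (cq_int h), h.2.2.1]
  · unfold sg
    exact ((Complex.continuous_ofReal.comp hc).inv₀ fun x =>
      Complex.ofReal_ne_zero.2 (hp_pos h ht x).ne').smul (Hm_continuous h ht)
  · unfold sg
    refine (Hm_psd h ht x).smul ?_
    rw [← Complex.ofReal_inv, Complex.zero_le_real]
    exact inv_nonneg.2 (hp_pos h ht x).le
  · unfold sg
    rw [Matrix.trace_smul, Hm_trace h ht, smul_eq_mul, inv_mul_cancel₀]
    exact_mod_cast (hp_pos h ht x).ne'

theorem moment_flow (h : IsCQState q σ) (hX : Integrable fun x : En n => ‖x‖ ^ 2 * q x) {t : ℝ}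
    (ht : 0 < t) : Integrable fun x : En n => ‖x‖ ^ 2 * hflow t q x := by
  obtain ⟨C, hC, hb⟩ := hp2_le h hX ht
  have hc := hflow_continuous ht (cq_int h)
  refine ((mdom_int h hX ht).const_mul C).mono'
    (Continuous.aestronglyMeasurable (by fun_prop)) (Eventually.of_forall fun x => ?_)
  have hp := hp_pos h ht x
  rw [Real.norm_eq_abs, abs_of_nonneg (by positivity)]
  have := hb x
  linarith

theorem vn_norm (h : IsCQState q σ) {t : ℝ} (ht : 0 < t) (x : En n) :
    hflow t q x * vnEnt (sg q σ t x) =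
      vnEnt (Hm q σ t x) + hflow t q x * Real.log (hflow t q x) := by
  have hs := (cq_flow h ht).2.2.2.2 x
  have h1 := vnEnt_smul hs.1.1 (hflow t q x)
  rw [hs.2] at h1
  have h2 : ((hflow t q x : ℝ) : ℂ) • sg q σ t x = Hm q σ t x := by
    unfold sg
    rw [smul_smul, mul_inv_cancel₀, one_smul]
    exact_mod_cast (hp_pos h ht x).ne'
  rw [h2] at h1
  rw [h1]
  simp [negMulLog]

theorem ent_flow (h : IsCQState q σ) (hX : Integrable fun x : En n => ‖x‖ ^ 2 * q x) {t : ℝ}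
    (ht : 0 < t) : EntFinite (hflow t q) (sg q σ t) := by
  refine ⟨hplog_int h hX ht, ?_⟩
  simp only [vn_norm h ht]
  exact (vnEnt_Hm_int h hX ht).add (hplog_int h hX ht)

theorem avg_flow (h : IsCQState q σ) {t : ℝ} (ht : 0 < t) :
    avgState (hflow t q) (sg q σ t) = avgState q σ := by
  ext i j
  have h1 : (fun x => ((hflow t q x : ℝ) : ℂ) * sg q σ t x i j) = hflow t (Rm q σ i j) :=
    Rm_sg h ht i j
  simp only [avgState, Matrix.of_apply]
  rw [h1, hflow_integral ht (Rm_int h i j)]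
  rfl

theorem condEnt_flow (h : IsCQState q σ) (hX : Integrable fun x : En n => ‖x‖ ^ 2 * q x) {t : ℝ}
    (ht : 0 < t) :
    condEnt (hflow t q) (sg q σ t) = Phi q σ t - vnEnt (avgState q σ) := by
  unfold condEnt clEnt
  rw [avg_flow h ht]
  simp only [vn_norm h ht]
  rw [integral_add (vnEnt_Hm_int h hX ht) (hplog_int h hX ht)]
  unfold Phi
  ring

theorem heatEnt_eq (h : IsCQState q σ) (hX : Integrable fun x : En n => ‖x‖ ^ 2 * q x) {t : ℝ}
    (ht : 0 < t) : heatEnt q σ t = Phi q σ t - vnEnt (avgState q σ) := by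
  unfold heatEnt
  rw [margFst_eq ht, margFstState_eq ht, condEnt_flow h hX ht]

theorem Phi_semigroup (h : IsCQState q σ) {s t : ℝ} (hs : 0 < s) (ht : 0 < t) :
    Phi (hflow t q) (sg q σ t) s = Phi q σ (s + t) := by
  unfold Phi
  congr 1
  funext x
  congr 1
  ext i j
  rw [Hm_apply, Hm_apply, Rm_sg h ht, hflow_hflow hs ht (Rm_int h i j)]

/-- The shear `(w, z) ↦ (w - c z, z)`. -/
def shear (n : ℕ) (c : ℝ) : (En n × En n) ≃ᵐ (En n × En n) where
  toFun p := (p.1 - c • p.2, p.2)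
  invFun p := (p.1 + c • p.2, p.2)
  left_inv p := by simp
  right_inv p := by simp
  measurable_toFun := by
    have : Continuous fun p : En n × En n => (p.1 - c • p.2, p.2) := by fun_prop
    exact this.measurable
  measurable_invFun := by
    have : Continuous fun p : En n × En n => (p.1 + c • p.2, p.2) := by fun_prop
    exact this.measurable

theorem shear_mp (c : ℝ) : MeasurePreserving (shear n c) volume volume := by
  have h1 : MeasurePreserving (fun p : En n × En n => (p.1, p.2 - c • p.1))
      (volume.prod volume) (volume.prod volume) := by
    refine (MeasurePreserving.id volume).skew_product (g := fun z w => w - c • z) ?_ ?_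
    · have : Continuous fun p : En n × En n => p.2 - c • p.1 := by fun_prop
      exact this.measurable
    · exact Eventually.of_forall fun z => (measurePreserving_sub_right volume (c • z)).map_eq
  have h2 := (Measure.measurePreserving_swap (μ := (volume : Measure (En n)))
    (ν := (volume : Measure (En n))))
  exact h2.comp (h1.comp h2)

theorem shear_integral {F : Type*} [NormedAddCommGroup F] [NormedSpace ℝ F] (c : ℝ)
    (f : En n × En n → F) : ∫ p : En n × En n, f (p.1 - c • p.2, p.2) = ∫ p, f p :=
  (shear_mp c).integral_comp' f

theorem gauss_int (n : ℕ) : Integrable (gaussDensity n) := by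
  have : gaussDensity n = hk n 1 := funext gauss_eq_hk
  rw [this]; exact hk_integrable one_pos

theorem gauss_integral (n : ℕ) : ∫ z, gaussDensity n z = 1 := by
  simp only [gauss_eq_hk]; exact hk_integral one_pos

theorem gauss_pos (z : En n) : 0 < gaussDensity n z := by
  rw [gauss_eq_hk]; exact hk_pos one_pos z

theorem glog_int (n : ℕ) :
    Integrable fun z : En n => gaussDensity n z * Real.log (gaussDensity n z) := by
  obtain ⟨C, hC, hb⟩ := hk_dom (n := n) one_pos
  have h1 : Integrable fun z : En n => ‖z‖ ^ 2 * gaussDensity n z := by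
    refine ((dom_integrable one_pos).const_mul C).mono' ?_ (Eventually.of_forall fun z => ?_)
    · have : Continuous fun z : En n => ‖z‖ ^ 2 * gaussDensity n z := by
        unfold gaussDensity; fun_prop
      exact this.aestronglyMeasurable
    · have hp := gauss_pos z
      rw [Real.norm_eq_abs, abs_of_nonneg (by positivity)]
      have := (hb 1 (by norm_num) (by norm_num) z).1
      rw [← gauss_eq_hk] at this
      linarith
  refine (((gauss_int n).const_mul (Real.log ((2 * π) ^ (-(n : ℝ) / 2)))).sub
    (h1.const_mul (1 / 2))).congr (Eventually.of_forall fun z => ?_)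
  have : Real.log (gaussDensity n z) = Real.log ((2 * π) ^ (-(n : ℝ) / 2)) + (-‖z‖ ^ 2 / 2) := by
    unfold gaussDensity
    rw [Real.log_mul (by positivity) (Real.exp_pos _).ne', Real.log_exp]
  simp only [this, Pi.sub_apply]
  ring

theorem margSnd_eq (h : IsCQState q σ) (c : ℝ) :
    margSnd (noisyDensity c q) = gaussDensity n := by
  funext z
  simp only [margSnd, noisyDensity]
  rw [integral_const_mul, integral_sub_right_eq_self, h.2.2.1, mul_one]

theorem margSndState_eq (h : IsCQState q σ) (c : ℝ) :
    margSndState (noisyDensity c q) (noisyState c σ) = fun _ => avgState q σ := by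
  funext z
  unfold margSndState
  rw [margSnd_eq h]
  ext i j
  simp only [Matrix.smul_apply, Matrix.of_apply, noisyDensity, noisyState, avgState,
    Complex.ofReal_mul, mul_assoc, smul_eq_mul]
  rw [integral_const_mul, integral_sub_right_eq_self (fun w => (q w : ℂ) * σ w i j),
    inv_mul_cancel_left₀]
  exact_mod_cast (gauss_pos z).ne'

theorem condEnt_snd (h : IsCQState q σ) (c : ℝ) :
    condEnt (margSnd (noisyDensity c q)) (margSndState (noisyDensity c q) (noisyState c σ)) =
      clEnt (gaussDensity n) := by
  rw [margSnd_eq h, margSndState_eq h]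
  have e : avgState (gaussDensity n) (fun _ => avgState q σ) = avgState q σ := by
    ext i j
    simp only [avgState, Matrix.of_apply]
    rw [integral_mul_const, integral_complex_ofReal, gauss_integral]
    simp
  unfold condEnt
  rw [e, integral_mul_const, gauss_integral]
  ring

theorem condEnt_joint (h : IsCQState q σ) (hf : EntFinite q σ) (c : ℝ) :
    condEnt (noisyDensity c q) (noisyState c σ) = clEnt (gaussDensity n) + condEnt q σ := by
  have e1 : ∫ p : En n × En n, noisyDensity c q p * vnEnt (noisyState c σ p) =
      ∫ x, q x * vnEnt (σ x) := by
    have := shear_integral c fun p : En n × En n => (q p.1 * vnEnt (σ p.1)) * gaussDensity n p.2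
    have h2 := integral_prod_mul (μ := (volume : Measure (En n))) (ν := (volume : Measure (En n)))
      (fun x => q x * vnEnt (σ x)) (gaussDensity n)
    rw [gauss_integral, mul_one] at h2
    rw [← h2]
    refine Eq.trans ?_ this
    refine integral_congr_ae (Eventually.of_forall fun p => ?_)
    simp only [noisyDensity, noisyState]
    ring
  have e2 : clEnt (noisyDensity c q) = clEnt q + clEnt (gaussDensity n) := by
    have := shear_integral c fun p : En n × En n =>
      (q p.1 * Real.log (q p.1)) * gaussDensity n p.2 +
        q p.1 * (gaussDensity n p.2 * Real.log (gaussDensity n p.2))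
    have h2 : ∫ p : En n × En n, ((q p.1 * Real.log (q p.1)) * gaussDensity n p.2 +
        q p.1 * (gaussDensity n p.2 * Real.log (gaussDensity n p.2))) =
        (∫ x, q x * Real.log (q x)) * 1 + 1 * ∫ z, gaussDensity n z * Real.log (gaussDensity n z) := by
      have i1 := hf.1.mul_prod (gauss_int n)
      have i2 := (cq_int h).mul_prod (glog_int n)
      have e := integral_add i1 i2
      rw [integral_prod_mul (fun x => q x * Real.log (q x)) (gaussDensity n), integral_prod_mul q
        (fun z => gaussDensity n z * Real.log (gaussDensity n z)), gauss_integral, h.2.2.1] at e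
      exact e
    unfold clEnt
    rw [← neg_add]
    congr 1
    rw [mul_one, one_mul] at h2
    rw [← h2]
    refine Eq.trans ?_ this
    refine integral_congr_ae (Eventually.of_forall fun p => ?_)
    simp only [noisyDensity]
    by_cases hq : q (p.1 - c • p.2) = 0
    · simp [hq]
    · rw [Real.log_mul (gauss_pos _).ne' hq]; ring
  have e3 : avgState (noisyDensity c q) (noisyState c σ) = avgState q σ := by
    ext i j
    simp only [avgState, Matrix.of_apply]
    have := shear_integral c fun p : En n × En n =>
      ((q p.1 : ℂ) * σ p.1 i j) * ((gaussDensity n p.2 : ℝ) : ℂ)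
    have h2 := integral_prod_mul (μ := (volume : Measure (En n))) (ν := (volume : Measure (En n)))
      (fun x => (q x : ℂ) * σ x i j) (fun z => ((gaussDensity n z : ℝ) : ℂ))
    rw [integral_complex_ofReal, gauss_integral, Complex.ofReal_one, mul_one] at h2
    rw [← h2]
    refine Eq.trans ?_ this
    refine integral_congr_ae (Eventually.of_forall fun p => ?_)
    simp only [noisyDensity, noisyState, Complex.ofReal_mul]
    ring
  unfold condEnt
  rw [e1, e2, e3]
  ring

theorem noisyMI_eq (h : IsCQState q σ) (hf : EntFinite q σ) (s : ℝ) :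
    noisyMI (√s) q σ = heatEnt q σ s - condEnt q σ := by
  unfold noisyMI condMI
  rw [condEnt_snd h, condEnt_joint h hf]
  unfold heatEnt
  ring

theorem slope_flow (h : IsCQState q σ) (hX : Integrable fun x : En n => ‖x‖ ^ 2 * q x) {t s : ℝ}
    (ht : 0 < t) (hs : 0 < s) :
    fisherSlope (hflow t q) (sg q σ t) s = (Phi q σ (s + t) - Phi q σ t) / s := by
  unfold fisherSlope
  rw [noisyMI_eq (cq_flow h ht) (ent_flow h hX ht), heatEnt_eq (cq_flow h ht) (moment_flow h hX ht) hs,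
    condEnt_flow h hX ht, avg_flow h ht, Phi_semigroup h hs ht]
  congr 1
  ring
end

/-- The de Bruijn identity along the heat flow, with quantum conditioning: for every
`t > 0`, the function `s ↦ S(X + √s Z | M)` is differentiable at `s = t` with derivative
the (finite) conditional Fisher information `J(X + √t Z | M)`. -/
theorem de_bruijn_flow_quantum_conditioning {n d : ℕ}
    (q : En n → ℝ) (σ : En n → Matrix (Fin d) (Fin d) ℂ)
    (hcq : IsCQState q σ)
    (hX2 : Integrable fun x : En n => ‖x‖ ^ 2 * q x)
    (hfin : EntFinite q σ) :
    ∀ t : ℝ, 0 < t →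
      ∃ Jt : ℝ,
        Tendsto
          (fisherSlope (margFst (noisyDensity (Real.sqrt t) q))
            (margFstState (noisyDensity (Real.sqrt t) q) (noisyState (Real.sqrt t) σ)))
          (𝓝[>] 0) (𝓝 Jt) ∧
        HasDerivAt (heatEnt q σ) Jt t := by
  intro t ht
  obtain ⟨D, hD⟩ := Phi_deriv hcq hX2 ht
  refine ⟨D, ?_, ?_⟩
  · rw [margFst_eq ht, margFstState_eq ht]
    have h1 := hD.tendsto_slope_zero_right
    refine h1.congr' ?_
    filter_upwards [self_mem_nhdsWithin] with s hs
    rw [slope_flow hcq hX2 ht hs, smul_eq_mul, add_comm s t]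
    ring
  · refine (hD.sub_const (vnEnt (avgState q σ))).congr_of_eventuallyEq ?_
    filter_upwards [lt_mem_nhds ht] with s hs
    exact heatEnt_eq hcq hX2 hs

end
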